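/- Every Schur idempotent in the Boolean lattice 𝔠(H) generated by the contractive Schur idempotents belongs to 𝔉H; in particular, the range of every Φ ∈ 𝔠(H) is a hyperreflexive subspace of B(H). -/

import Mathlib

open scoped InnerProductSpace Pointwise

noncomputable section

namespace SchurHyper

/-- `B H` is the algebra of bounded linear operators on `H`. -/
abbrev B (H : Type*) [NormedAddCommGroup H] [InnerProductSpace ℂ H] : Type _ := H →L[ℂ] H

variable (H : Type*) [NormedAddCommGroup H] [InnerProductSpace ℂ H]

/-- A linear functional on `B H` is *normal* (weak* continuous) if it arises from
the duality with the trace class, i.e. it is of the form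
`T ↦ ∑ₙ ⟪yₙ, T xₙ⟫` for square-summable sequences `(xₙ)`, `(yₙ)`
(recall that the inner product is conjugate-linear in its first slot). -/
def IsNormalFunctional (ω : B H →ₗ[ℂ] ℂ) : Prop :=
  ∃ x y : ℕ → H, Summable (fun n => ‖x n‖ ^ 2) ∧ Summable (fun n => ‖y n‖ ^ 2) ∧
    ∀ T : B H, ω T = ∑' n, ⟪y n, T (x n)⟫_ℂ

/-- The weak* topology on `B H`: the topology induced by the normal functionals. -/
def weakStarTopology : TopologicalSpace (B H) :=
  TopologicalSpace.induced
    (fun (T : B H) (ω : {ω : B H →ₗ[ℂ] ℂ // IsNormalFunctional H ω}) => ω.1 T)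
    inferInstance

/-- A set of operators is weak* closed if it is closed in the weak* topology. -/
def WStarClosed (X : Set (B H)) : Prop := @IsClosed _ (weakStarTopology H) X

/-- The weak* closure of a set of operators. -/
def wStarClosure (X : Set (B H)) : Set (B H) := @closure _ (weakStarTopology H) X

/-- A map on `B H` is weak* continuous if it is continuous with respect to the
weak* topology on both sides. -/
def WStarContinuous (Φ : B H →L[ℂ] B H) : Prop :=
  @Continuous _ _ (weakStarTopology H) (weakStarTopology H) Φ

variable {H}
variable [CompleteSpace H]

/-- A maximal abelian selfadjoint subalgebra of `B H`: an abelian selfadjoint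
subalgebra which contains every operator commuting with it (equivalently, it
coincides with its own commutant). -/
def IsMasa (D : StarSubalgebra ℂ (B H)) : Prop :=
  (∀ A ∈ D, ∀ C ∈ D, A * C = C * A) ∧
  (∀ T : B H, (∀ A ∈ D, T * A = A * T) → T ∈ D)

/-- A Schur multiplier: a weak* continuous `D`-bimodule map on `B H`. -/
def IsSchurMultiplier (D : StarSubalgebra ℂ (B H)) (Φ : B H →L[ℂ] B H) : Prop :=
  WStarContinuous H Φ ∧ ∀ A ∈ D, ∀ C ∈ D, ∀ T : B H, Φ (A * T * C) = A * Φ T * C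

/-- A Schur idempotent: an idempotent Schur multiplier. -/
def IsSchurIdempotent (D : StarSubalgebra ℂ (B H)) (Φ : B H →L[ℂ] B H) : Prop :=
  IsSchurMultiplier D Φ ∧ Φ.comp Φ = Φ

/-- A subspace `X ⊆ B H` is a `D`-bimodule if `D X D ⊆ X`. -/
def IsBimodule (D : StarSubalgebra ℂ (B H)) (X : Submodule ℂ (B H)) : Prop :=
  ∀ A ∈ D, ∀ C ∈ D, ∀ T ∈ X, A * T * C ∈ X

/-- The Arveson distance `α(T, X)`. -/
def arveson (T : B H) (X : Set (B H)) : ℝ :=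
  ⨆ ξ : {ξ : H // ‖ξ‖ = 1}, ⨅ S : X, ‖T ξ.1 - S.1 ξ.1‖

/-- The set of hyperreflexivity constants of `X`. -/
def hyperSet (X : Set (B H)) : Set ℝ :=
  {k | 0 < k ∧ ∀ T : B H, Metric.infDist T X ≤ k * arveson T X}

/-- A subspace is hyperreflexive if `d(T, X) ≤ k ⬝ α(T, X)` for some `k > 0`. -/
def Hyperreflexive (X : Set (B H)) : Prop := (hyperSet X).Nonempty

/-- The hyperreflexivity constant `k(X)`: the least constant that works. -/
def hyperConst (X : Set (B H)) : ℝ := sInf (hyperSet X)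

/-- The set of constants `λ` witnessing that a Schur idempotent lies in `𝔉H`. -/
def lamSet (Φ : B H →L[ℂ] B H) : Set ℝ :=
  {l | 0 < l ∧ ∀ T : B H, ‖T - Φ T‖ ≤ l * arveson T (Set.range Φ)}

/-- The class `𝔉H` of Schur idempotents `Φ` such that
`‖T - Φ T‖ ≤ λ ⬝ α(T, ran Φ)` for some `λ > 0` and all `T`. -/
def MemFH (D : StarSubalgebra ℂ (B H)) (Φ : B H →L[ℂ] B H) : Prop :=
  IsSchurIdempotent D Φ ∧ (lamSet Φ).Nonempty

/-- The constant `λ(Φ)`: the least constant witnessing membership of `𝔉H`. -/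
def lam (Φ : B H →L[ℂ] B H) : ℝ := sInf (lamSet Φ)

/-- A ternary masa-bimodule condition: `S T* R ∈ M` whenever `S, T, R ∈ M`. -/
def IsTernary (M : Submodule ℂ (B H)) : Prop :=
  ∀ S ∈ M, ∀ T ∈ M, ∀ R ∈ M, S * star T * R ∈ M

end SchurHyper

open SchurHyper

/-- The Boolean lattice `𝔠(H)` of Schur idempotents generated by the contractive
Schur idempotents, under meet `Φ∧Ψ = Φ∘Ψ`, join `Φ∨Ψ = Φ+Ψ−Φ∘Ψ` and
complement `Φ^⊥ = id − Φ`. -/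
inductive InC {H : Type*} [NormedAddCommGroup H] [InnerProductSpace ℂ H] [CompleteSpace H]
    (D : StarSubalgebra ℂ (B H)) : (B H →L[ℂ] B H) → Prop
  | base (Φ : B H →L[ℂ] B H) (h : IsSchurIdempotent D Φ) (hc : ‖Φ‖ ≤ 1) : InC D Φ
  | compl (Φ : B H →L[ℂ] B H) (h : InC D Φ) : InC D (ContinuousLinearMap.id ℂ (B H) - Φ)
  | meet (Φ Ψ : B H →L[ℂ] B H) (h1 : InC D Φ) (h2 : InC D Ψ) : InC D (Φ.comp Ψ)
  | join (Φ Ψ : B H →L[ℂ] B H) (h1 : InC D Φ) (h2 : InC D Ψ) : InC D (Φ + Ψ - Φ.comp Ψ)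

namespace SchurHyper

open Filter Topology InnerProductSpace

variable {H : Type*} [NormedAddCommGroup H] [InnerProductSpace ℂ H]

/-- A functional which is normal is continuous for the weak* topology. -/
theorem IsNormalFunctional.continuous {ω : B H →ₗ[ℂ] ℂ} (hω : IsNormalFunctional H ω) :
    @Continuous _ _ (weakStarTopology H) _ ω := by
  let _ := weakStarTopology H
  have h : Continuous fun (T : B H) (ω : {ω : B H →ₗ[ℂ] ℂ // IsNormalFunctional H ω}) => ω.1 T :=
    continuous_induced_dom
  exact continuous_pi_iff.1 h ⟨ω, hω⟩

/-- The vector functional `T ↦ ⟪y, T x⟫`. -/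
def vectorFunctional (x y : H) : B H →ₗ[ℂ] ℂ where
  toFun T := ⟪y, T x⟫_ℂ
  map_add' S T := by simp
  map_smul' c T := by simp

theorem isNormalFunctional_vectorFunctional (x y : H) :
    IsNormalFunctional H (vectorFunctional x y) := by
  refine ⟨Pi.single 0 x, Pi.single 0 y, ?_, ?_, fun T => ?_⟩
  · exact summable_of_ne_finset_zero (s := {0}) fun n hn => by
      simp [Pi.single_eq_of_ne (show n ≠ 0 by simpa using hn)]
  · exact summable_of_ne_finset_zero (s := {0}) fun n hn => by
      simp [Pi.single_eq_of_ne (show n ≠ 0 by simpa using hn)]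
  · rw [tsum_eq_single 0]
    · simp [vectorFunctional]
    · intro n hn
      simp [Pi.single_eq_of_ne hn]

theorem wStarContinuous_of_forall {Φ : B H →L[ℂ] B H}
    (h : ∀ ω : B H →ₗ[ℂ] ℂ, IsNormalFunctional H ω →
      @Continuous _ _ (weakStarTopology H) _ (fun T => ω (Φ T))) : WStarContinuous H Φ := by
  let _ := weakStarTopology H
  exact continuous_induced_rng.2 (continuous_pi fun ω => h ω.1 ω.2)

theorem WStarContinuous.comp {Φ Ψ : B H →L[ℂ] B H} (hΦ : WStarContinuous H Φ)
    (hΨ : WStarContinuous H Ψ) : WStarContinuous H (Φ.comp Ψ) := by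
  exact @Continuous.comp _ _ _ (weakStarTopology H) (weakStarTopology H) (weakStarTopology H)
    Ψ Φ hΦ hΨ

theorem WStarContinuous.add {Φ Ψ : B H →L[ℂ] B H} (hΦ : WStarContinuous H Φ)
    (hΨ : WStarContinuous H Ψ) : WStarContinuous H (Φ + Ψ) := by
  let _ := weakStarTopology H
  refine wStarContinuous_of_forall fun ω hω => ?_
  simp only [add_apply, map_add]
  exact (hω.continuous.comp hΦ).add (hω.continuous.comp hΨ)

theorem WStarContinuous.sub {Φ Ψ : B H →L[ℂ] B H} (hΦ : WStarContinuous H Φ)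
    (hΨ : WStarContinuous H Ψ) : WStarContinuous H (Φ - Ψ) := by
  let _ := weakStarTopology H
  refine wStarContinuous_of_forall fun ω hω => ?_
  simp only [sub_apply, map_sub]
  exact (hω.continuous.comp hΦ).sub (hω.continuous.comp hΨ)

theorem wStarContinuous_id : WStarContinuous H (ContinuousLinearMap.id ℂ (B H)) := by
  let _ := weakStarTopology H
  exact continuous_id

/-- The projection onto the span of finitely many vectors of an orthonormal family. -/
def finProj {ι : Type*} (b : ι → H) (s : Finset ι) : B H := ∑ i ∈ s, rankOne ℂ (b i) (b i)

theorem finProj_apply {ι : Type*} (b : ι → H) (s : Finset ι) (x : H) :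
    finProj b s x = ∑ i ∈ s, ⟪b i, x⟫_ℂ • b i := by
  simp [finProj]

theorem norm_finProj_apply_le {ι : Type*} {b : ι → H} (hb : Orthonormal ℂ b) (s : Finset ι)
    (x : H) : ‖finProj b s x‖ ≤ ‖x‖ := by
  have h : ‖finProj b s x‖ ^ 2 = ∑ i ∈ s, ‖⟪b i, x⟫_ℂ‖ ^ 2 := by
    have h1 := hb.inner_sum (fun i => ⟪b i, x⟫_ℂ) (fun i => ⟪b i, x⟫_ℂ) s
    rw [← finProj_apply, inner_self_eq_norm_sq_to_K] at h1
    have h2 : ∀ i, (starRingEnd ℂ) ⟪b i, x⟫_ℂ * ⟪b i, x⟫_ℂ = ((‖⟪b i, x⟫_ℂ‖ ^ 2 : ℝ) : ℂ) := by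
      intro i
      rw [Complex.conj_mul']
      norm_cast
    simp only [h2] at h1
    apply Complex.ofReal_injective
    simpa using h1
  have := hb.sum_inner_products_le x (s := s)
  rw [← h] at this
  exact le_of_sq_le_sq this (norm_nonneg _)

theorem tendsto_finProj {ι : Type*} (b : HilbertBasis ι ℂ H) (x : H) :
    Tendsto (fun s => finProj b s x) atTop (𝓝 x) := by
  have := b.hasSum_repr x
  simp only [b.repr_apply_apply] at this
  simpa only [finProj_apply, HasSum, SummationFilter.unconditional_filter] using this

/-- Compressions of an operator by finite rank projections converge weak* to it. -/
theorem tendsto_mul_finProj {ι : Type*} (b : HilbertBasis ι ℂ H) (T : B H) :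
    Tendsto (fun s => T * finProj b s) atTop (@nhds _ (weakStarTopology H) T) := by
  let _ := weakStarTopology H
  rw [(show @nhds _ (weakStarTopology H) T = _ from nhds_induced _ _), tendsto_comap_iff,
    tendsto_pi_nhds]
  rintro ⟨ω, x, y, hx, hy, hω⟩
  simp only [Function.comp_apply, hω]
  refine tendsto_tsum_of_dominated_convergence
    (bound := fun n => ‖T‖ * (‖x n‖ ^ 2 + ‖y n‖ ^ 2)) ((hx.add hy).mul_left _) ?_ ?_
  · intro n
    have h1 := (T.continuous.tendsto _).comp (tendsto_finProj b (x n))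
    exact Tendsto.inner tendsto_const_nhds h1
  · refine Eventually.of_forall fun s n => ?_
    calc ‖⟪y n, (T * finProj b s) (x n)⟫_ℂ‖ ≤ ‖y n‖ * ‖T (finProj b s (x n))‖ :=
          norm_inner_le_norm _ _
      _ ≤ ‖y n‖ * (‖T‖ * ‖x n‖) := by
          gcongr
          exact (T.le_opNorm _).trans (by gcongr; exact norm_finProj_apply_le b.orthonormal s _)
      _ ≤ ‖T‖ * (‖x n‖ ^ 2 + ‖y n‖ ^ 2) := by
          nlinarith [sq_nonneg (‖x n‖ - ‖y n‖), norm_nonneg T,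
            mul_nonneg (norm_nonneg T) (sq_nonneg (‖x n‖ - ‖y n‖)),
            mul_nonneg (norm_nonneg T) (sq_nonneg (‖x n‖ + ‖y n‖))]

/-- A weak* continuous map which agrees with a two-sided multiplication on the operators of rank
one (after multiplication by fixed operators) agrees with it everywhere. -/
theorem WStarContinuous.eq_of_rankOne [CompleteSpace H] {Φ : B H →L[ℂ] B H}
    (hΦ : WStarContinuous H Φ) {E F A C : B H}
    (h : ∀ x y : H, E * Φ (rankOne ℂ x y) * F = A * rankOne ℂ x y * C) (T : B H) :
    E * Φ T * F = A * T * C := by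
  obtain ⟨w, b, -⟩ := exists_hilbertBasis ℂ H
  let _ := weakStarTopology H
  refine ContinuousLinearMap.ext fun x => ext_inner_left ℂ fun y => ?_
  have hf : ∀ s, ⟪E.adjoint y, Φ (T * finProj b s) (F x)⟫_ℂ
      = ⟪A.adjoint y, (T * finProj b s) (C x)⟫_ℂ := by
    intro s
    rw [ContinuousLinearMap.adjoint_inner_left, ContinuousLinearMap.adjoint_inner_left]
    have : E * Φ (T * finProj b s) * F = A * (T * finProj b s) * C := by
      simp only [finProj, Finset.mul_sum, map_sum, Finset.sum_mul]
      refine Finset.sum_congr rfl fun i _ => ?_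
      rw [ContinuousLinearMap.mul_def T, comp_rankOne]
      exact h _ _
    exact congrArg (fun S : B H => ⟪y, S x⟫_ℂ) this
  have h1 : Tendsto (fun s => ⟪E.adjoint y, Φ (T * finProj b s) (F x)⟫_ℂ) atTop
      (𝓝 ⟪E.adjoint y, Φ T (F x)⟫_ℂ) :=
    (((isNormalFunctional_vectorFunctional (F x) (E.adjoint y)).continuous.comp hΦ).tendsto T).comp
      (tendsto_mul_finProj b T)
  have h2 : Tendsto (fun s => ⟪A.adjoint y, (T * finProj b s) (C x)⟫_ℂ) atTop
      (𝓝 ⟪A.adjoint y, T (C x)⟫_ℂ) :=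
    ((isNormalFunctional_vectorFunctional (C x) (A.adjoint y)).continuous.tendsto T).comp
      (tendsto_mul_finProj b T)
  simp only [hf] at h1
  have := tendsto_nhds_unique h1 h2
  rw [ContinuousLinearMap.adjoint_inner_left, ContinuousLinearMap.adjoint_inner_left] at this
  exact this

end SchurHyper

namespace SchurHyper

open Filter Topology InnerProductSpace

variable {H : Type*} [NormedAddCommGroup H] [InnerProductSpace ℂ H] [CompleteSpace H]
variable {D : StarSubalgebra ℂ (B H)}

theorem IsMasa.starProjection_mem (hD : IsMasa D) (K : Submodule ℂ H) [K.HasOrthogonalProjection]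
    (hK : ∀ A ∈ D, ∀ x ∈ K, A x ∈ K) : K.starProjection ∈ D := by
  refine hD.2 _ fun A hA => ContinuousLinearMap.ext fun x => ?_
  refine Submodule.eq_starProjection_of_mem_orthogonal
    (hK A hA _ (K.starProjection_apply_mem x)) ?_
  change A x - A (K.starProjection x) ∈ Kᗮ
  rw [← map_sub, Submodule.mem_orthogonal]
  intro u hu
  rw [← ContinuousLinearMap.adjoint_inner_left]
  exact K.sub_starProjection_mem_orthogonal x _ (hK _ (star_mem hA) _ hu)

/-- The closed subspace generated by a vector under an algebra of operators. -/
def cyclicSubspace (D : StarSubalgebra ℂ (B H)) (x : H) : Submodule ℂ H :=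
  (D.toSubalgebra.toSubmodule.map (ContinuousLinearMap.apply ℂ H x).toLinearMap).topologicalClosure

instance (x : H) : (cyclicSubspace D x).HasOrthogonalProjection := by
  have : CompleteSpace (cyclicSubspace D x) :=
    (Submodule.isClosed_topologicalClosure _).completeSpace_coe
  infer_instance

theorem apply_mem_cyclicSubspace {A : B H} (hA : A ∈ D) (x : H) : A x ∈ cyclicSubspace D x :=
  Submodule.le_topologicalClosure _ ⟨A, hA, rfl⟩

theorem self_mem_cyclicSubspace (x : H) : x ∈ cyclicSubspace D x :=
  apply_mem_cyclicSubspace (one_mem D) x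

theorem cyclicSubspace_le {x : H} {K : Submodule ℂ H} (hK : IsClosed (K : Set H))
    (h : ∀ A ∈ D, A x ∈ K) : cyclicSubspace D x ≤ K := by
  refine Submodule.topologicalClosure_minimal _ ?_ hK
  rintro _ ⟨A, hA, rfl⟩
  exact h A hA

theorem apply_mem_cyclicSubspace_of_mem {A : B H} (hA : A ∈ D) {x y : H}
    (hy : y ∈ cyclicSubspace D x) : A y ∈ cyclicSubspace D x := by
  have : cyclicSubspace D x ≤ (cyclicSubspace D x).comap A.toLinearMap :=
    cyclicSubspace_le ((Submodule.isClosed_topologicalClosure _).preimage A.continuous)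
      fun C hC => apply_mem_cyclicSubspace (mul_mem hA hC) x
  exact this hy

theorem IsMasa.cyclic_mem (hD : IsMasa D) (x : H) : (cyclicSubspace D x).starProjection ∈ D :=
  hD.starProjection_mem _ fun _ hA _ hy => apply_mem_cyclicSubspace_of_mem hA hy

theorem starProjection_cyclic_self (x : H) : (cyclicSubspace D x).starProjection x = x :=
  Submodule.starProjection_eq_self_iff.2 (self_mem_cyclicSubspace x)

/-- Operators which agree on the orbit of `x` agree on its cyclic subspace. -/
theorem mul_starProjection_cyclic_eq {Z W : B H} {x : H} (h : ∀ A ∈ D, Z (A x) = W (A x)) :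
    Z * (cyclicSubspace D x).starProjection = W * (cyclicSubspace D x).starProjection := by
  have : cyclicSubspace D x ≤ LinearMap.ker (Z - W).toLinearMap :=
    cyclicSubspace_le (Z - W).isClosed_ker fun A hA => by simp [h A hA]
  ext y
  have := this ((cyclicSubspace D x).starProjection_apply_mem y)
  simpa [sub_eq_zero] using this

/-- The properties of contractive Schur idempotents which determine their structure. -/
structure IsContrIdem (D : StarSubalgebra ℂ (B H)) (Ψ : B H →L[ℂ] B H) : Prop where
  bimod : ∀ A ∈ D, ∀ C ∈ D, ∀ T : B H, Ψ (A * T * C) = A * Ψ T * C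
  idem : ∀ T, Ψ (Ψ T) = Ψ T
  norm_le : ∀ T, ‖Ψ T‖ ≤ ‖T‖
  eq_of_rankOne : ∀ E F A C : B H,
    (∀ x y : H, E * Ψ (rankOne ℂ x y) * F = A * rankOne ℂ x y * C) →
      ∀ T, E * Ψ T * F = A * T * C

theorem IsSchurIdempotent.isContrIdem {Ψ : B H →L[ℂ] B H} (h : IsSchurIdempotent D Ψ)
    (hc : ‖Ψ‖ ≤ 1) : IsContrIdem D Ψ where
  bimod := h.1.2
  idem T := congrArg (fun Φ : B H →L[ℂ] B H => Φ T) h.2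
  norm_le T := (Ψ.le_opNorm T).trans (mul_le_of_le_one_left (norm_nonneg _) hc)
  eq_of_rankOne _ _ _ _ hr := h.1.1.eq_of_rankOne hr

/-- The conjugate `T ↦ Ψ(T*)*` of a map on operators. -/
def conjMap (Ψ : B H →L[ℂ] B H) : B H →L[ℂ] B H :=
  LinearMap.mkContinuous
    { toFun := fun T => star (Ψ (star T))
      map_add' := fun S T => by simp
      map_smul' := fun c T => by simp } ‖Ψ‖ fun T => by
        simpa using Ψ.le_opNorm (star T)

@[simp] theorem conjMap_apply (Ψ : B H →L[ℂ] B H) (T : B H) :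
    conjMap Ψ T = star (Ψ (star T)) := rfl

theorem star_rankOne (x y : H) : star (rankOne ℂ x y) = rankOne ℂ y x := adjoint_rankOne x y

omit [CompleteSpace H] in
theorem mul_rankOne (A : B H) (x y : H) : A * rankOne ℂ x y = rankOne ℂ (A x) y :=
  comp_rankOne x y A

theorem rankOne_mul (A : B H) (x y : H) : rankOne ℂ x y * A = rankOne ℂ x (star A y) :=
  rankOne_comp x y A

namespace IsContrIdem

variable {Ψ : B H →L[ℂ] B H}

theorem mul_left (h : IsContrIdem D Ψ) {A : B H} (hA : A ∈ D) (T : B H) :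
    Ψ (A * T) = A * Ψ T := by
  simpa using h.bimod A hA 1 (one_mem D) T

theorem mul_right (h : IsContrIdem D Ψ) {A : B H} (hA : A ∈ D) (T : B H) :
    Ψ (T * A) = Ψ T * A := by
  simpa using h.bimod 1 (one_mem D) A hA T

theorem conj (h : IsContrIdem D Ψ) : IsContrIdem D (conjMap Ψ) where
  bimod A hA C hC T := by
    simp [h.bimod (star C) (star_mem hC) (star A) (star_mem hA), ← mul_assoc]
  idem T := by simp [h.idem]
  norm_le T := by simpa using h.norm_le (star T)
  eq_of_rankOne E F A C hr T := by
    have := h.eq_of_rankOne (star F) (star E) (star C) (star A) (fun x y => by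
      have := congrArg star (hr y x)
      simpa [star_rankOne, mul_assoc] using this) (star T)
    simpa [mul_assoc] using congrArg star this

end IsContrIdem

/-- The operator `x ↦ Ψ(x y*) z`. -/
def symbolOp (Ψ : B H →L[ℂ] B H) (y z : H) : B H :=
  ContinuousLinearMap.apply ℂ H z ∘L Ψ ∘L (rankOne ℂ (E := H) (F := H)).flip y

@[simp] theorem symbolOp_apply (Ψ : B H →L[ℂ] B H) (x y z : H) :
    symbolOp Ψ y z x = Ψ (rankOne ℂ x y) z := rfl

theorem IsContrIdem.symbolOp_mem {Ψ : B H →L[ℂ] B H} (h : IsContrIdem D Ψ) (hD : IsMasa D)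
    (y z : H) : symbolOp Ψ y z ∈ D := by
  refine hD.2 _ fun A hA => ContinuousLinearMap.ext fun x => ?_
  simp [← mul_rankOne, h.mul_left hA]

end SchurHyper

namespace SchurHyper

open Filter Topology InnerProductSpace

/-- A Bessel-type inequality in commutative C⋆-algebras. -/
theorem norm_sum_star_mul_self_le {A ι : Type*} [CommCStarAlgebra A] (s : Finset ι) (a : ι → A)
    {C : ℝ} (hC : 0 ≤ C)
    (h : ∀ α : ι → ℂ, ‖∑ i ∈ s, α i • a i‖ ^ 2 ≤ C * ∑ i ∈ s, ‖α i‖ ^ 2) :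
    ‖∑ i ∈ s, star (a i) * a i‖ ≤ C := by
  have hiso : ∀ x : A, ‖WeakDual.gelfandTransform ℂ A x‖ = ‖x‖ := fun x =>
    (gelfandTransform_isometry A).norm_map_of_map_zero (map_zero _) x
  rw [← hiso, ContinuousMap.norm_le _ hC]
  intro χ
  set S : ℝ := ∑ i ∈ s, ‖χ (a i)‖ ^ 2 with hS
  have hS0 : 0 ≤ S := Finset.sum_nonneg fun i _ => by positivity
  have h1 : ∀ i, (starRingEnd ℂ) (χ (a i)) * χ (a i) = ((‖χ (a i)‖ ^ 2 : ℝ) : ℂ) := by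
    intro i
    rw [Complex.conj_mul']
    norm_cast
  have h2 : WeakDual.gelfandTransform ℂ A (∑ i ∈ s, star (a i) * a i) χ = (S : ℂ) := by
    rw [WeakDual.gelfandTransform_apply_apply, map_sum, hS, Complex.ofReal_sum]
    refine Finset.sum_congr rfl fun i _ => ?_
    rw [map_mul, map_star, ← h1]
    rfl
  have h3 : χ (∑ i ∈ s, (starRingEnd ℂ) (χ (a i)) • a i) = (S : ℂ) := by
    rw [map_sum, hS, Complex.ofReal_sum]
    refine Finset.sum_congr rfl fun i _ => ?_
    rw [map_smul, smul_eq_mul, h1]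
  have h4 : S ≤ ‖∑ i ∈ s, (starRingEnd ℂ) (χ (a i)) • a i‖ := by
    rw [← hiso]
    refine le_trans ?_ (ContinuousMap.norm_coe_le_norm _ χ)
    rw [WeakDual.gelfandTransform_apply_apply, h3]
    simp [abs_of_nonneg hS0]
  have h5 := h fun i => (starRingEnd ℂ) (χ (a i))
  simp only [RCLike.norm_conj] at h5
  rw [← hS] at h5
  have h6 : S ^ 2 ≤ C * S := (by gcongr : S ^ 2 ≤ _).trans h5
  rw [h2, Complex.norm_real, Real.norm_eq_abs, abs_of_nonneg hS0]
  rcases hS0.eq_or_lt with h0 | h0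
  · rwa [← h0]
  · nlinarith

variable {H : Type*} [NormedAddCommGroup H] [InnerProductSpace ℂ H] [CompleteSpace H]
variable {D : StarSubalgebra ℂ (B H)} {Ψ : B H →L[ℂ] B H}

theorem IsMasa.isClosed (hD : IsMasa D) : IsClosed (D : Set (B H)) := by
  have : (D : Set (B H)) = ⋂ A ∈ D, {T | T * A = A * T} := by
    ext T
    simp only [SetLike.mem_coe, Set.mem_iInter, Set.mem_ofPred_eq]
    exact ⟨fun hT A hA => hD.1 T hT A hA, hD.2 T⟩
  rw [this]
  exact isClosed_biInter fun A _ =>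
    isClosed_eq (continuous_id.mul continuous_const) (continuous_const.mul continuous_id)

theorem IsMasa.norm_sum_star_mul_self_le (hD : IsMasa D) {ι : Type*} (s : Finset ι) (a : ι → B H)
    (ha : ∀ i, a i ∈ D) {C : ℝ} (hC : 0 ≤ C)
    (h : ∀ α : ι → ℂ, ‖∑ i ∈ s, α i • a i‖ ^ 2 ≤ C * ∑ i ∈ s, ‖α i‖ ^ 2) :
    ‖∑ i ∈ s, star (a i) * a i‖ ≤ C := by
  let _ : CStarAlgebra D := StarSubalgebra.cstarAlgebra D (h_closed := hD.isClosed)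
  let _ : CommCStarAlgebra D :=
    { (inferInstance : CStarAlgebra D) with
      mul_comm := fun x y => Subtype.ext (hD.1 _ x.2 _ y.2) }
  have := SchurHyper.norm_sum_star_mul_self_le (A := D) s (fun i => ⟨a i, ha i⟩) hC fun α => by
    have := h α
    have e : ((∑ i ∈ s, α i • (⟨a i, ha i⟩ : D) : D) : B H) = ∑ i ∈ s, α i • a i := by
      simp
    rw [← e] at this
    exact this
  have e : ((∑ i ∈ s, star (⟨a i, ha i⟩ : D) * ⟨a i, ha i⟩ : D) : B H)
      = ∑ i ∈ s, star (a i) * a i := by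
    simp
  rw [← e]
  exact this

omit [CompleteSpace H] in
theorem norm_sum_smul_sq {ι : Type*} {b : ι → H} (hb : Orthonormal ℂ b) (s : Finset ι)
    (α : ι → ℂ) : ‖∑ i ∈ s, α i • b i‖ ^ 2 = ∑ i ∈ s, ‖α i‖ ^ 2 := by
  have h1 := hb.inner_sum α α s
  rw [inner_self_eq_norm_sq_to_K] at h1
  have h2 : ∀ i, (starRingEnd ℂ) (α i) * α i = ((‖α i‖ ^ 2 : ℝ) : ℂ) := by
    intro i
    rw [Complex.conj_mul']
    norm_cast
  simp only [h2] at h1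
  apply Complex.ofReal_injective
  simpa using h1

namespace IsContrIdem

theorem norm_symbolOp_le (h : IsContrIdem D Ψ) (y z : H) : ‖symbolOp Ψ y z‖ ≤ ‖y‖ * ‖z‖ := by
  refine ContinuousLinearMap.opNorm_le_bound _ (by positivity) fun x => ?_
  calc ‖Ψ (rankOne ℂ x y) z‖ ≤ ‖Ψ (rankOne ℂ x y)‖ * ‖z‖ := ContinuousLinearMap.le_opNorm _ _
    _ ≤ (‖x‖ * ‖y‖) * ‖z‖ := by
        gcongr
        exact (h.norm_le _).trans_eq (norm_rankOne x y)
    _ = ‖y‖ * ‖z‖ * ‖x‖ := by ring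

theorem sum_norm_sq_le (h : IsContrIdem D Ψ) (hD : IsMasa D) (k y : H) {ι : Type*} {b : ι → H}
    (hb : Orthonormal ℂ b) (s : Finset ι) :
    ∑ i ∈ s, ‖Ψ (rankOne ℂ k y) (b i)‖ ^ 2 ≤ ‖y‖ ^ 2 * ‖k‖ ^ 2 := by
  have h1 := hD.norm_sum_star_mul_self_le s (fun i => symbolOp Ψ y (b i))
    (fun i => h.symbolOp_mem hD _ _) (sq_nonneg ‖y‖) fun α => by
      have e : ∑ i ∈ s, α i • symbolOp Ψ y (b i) = symbolOp Ψ y (∑ i ∈ s, α i • b i) := by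
        ext x
        simp
      rw [e, ← norm_sum_smul_sq hb, ← mul_pow]
      gcongr
      exact h.norm_symbolOp_le _ _
  have h2 : ((∑ i ∈ s, ‖Ψ (rankOne ℂ k y) (b i)‖ ^ 2 : ℝ) : ℂ)
      = ⟪k, (∑ i ∈ s, star (symbolOp Ψ y (b i)) * symbolOp Ψ y (b i)) k⟫_ℂ := by
    simp only [sum_apply, inner_sum, Complex.ofReal_sum]
    refine Finset.sum_congr rfl fun i _ => ?_
    change _ = ⟪k, (symbolOp Ψ y (b i)).adjoint (symbolOp Ψ y (b i) k)⟫_ℂ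
    rw [ContinuousLinearMap.adjoint_inner_right, symbolOp_apply, inner_self_eq_norm_sq_to_K]
    simp
  have h3 : (∑ i ∈ s, ‖Ψ (rankOne ℂ k y) (b i)‖ ^ 2 : ℝ)
      = ‖⟪k, (∑ i ∈ s, star (symbolOp Ψ y (b i)) * symbolOp Ψ y (b i)) k⟫_ℂ‖ := by
    rw [← h2, Complex.norm_real, Real.norm_eq_abs,
      abs_of_nonneg (Finset.sum_nonneg fun i _ => by positivity)]
  rw [h3]
  calc _ ≤ ‖k‖ * ‖(∑ i ∈ s, star (symbolOp Ψ y (b i)) * symbolOp Ψ y (b i)) k‖ :=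
        norm_inner_le_norm _ _
    _ ≤ ‖k‖ * (‖y‖ ^ 2 * ‖k‖) := by
        gcongr
        exact ContinuousLinearMap.le_of_opNorm_le _ h1 k
    _ = _ := by ring

/-- Contractive Schur idempotents map operators of rank one to compact operators. -/
theorem isCompactOperator_rankOne (h : IsContrIdem D Ψ) (hD : IsMasa D) (k y : H) :
    IsCompactOperator (Ψ (rankOne ℂ k y)) := by
  obtain ⟨w, b, -⟩ := exists_hilbertBasis ℂ H
  set T := Ψ (rankOne ℂ k y) with hT
  have hsum : Summable fun i => ‖T (b i)‖ ^ 2 :=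
    summable_of_sum_le (fun i => by positivity) fun s => h.sum_norm_sq_le hD k y b.orthonormal s
  have happ : ∀ s x, (T * finProj b s) x = ∑ i ∈ s, ⟪b i, x⟫_ℂ • T (b i) := fun s x => by
    change T (finProj b s x) = _
    simp [finProj_apply]
  refine isCompactOperator_of_tendsto (F := fun s => T * finProj b s) (l := atTop) ?_
    (Eventually.of_forall fun s => ?_)
  · rw [tendsto_iff_norm_sub_tendsto_zero]
    have h0 : Tendsto (fun s : Finset w => √(∑' i : {i // i ∉ s}, ‖T (b i)‖ ^ 2)) atTop (𝓝 0) := by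
      have := (Real.continuous_sqrt.tendsto _).comp
        (tendsto_tsum_compl_atTop_zero fun i => ‖T (b i)‖ ^ 2)
      simpa [Function.comp_def] using this
    refine squeeze_zero (fun _ => norm_nonneg _) (fun s => ?_) h0
    refine ContinuousLinearMap.opNorm_le_bound _ (Real.sqrt_nonneg _) fun x => ?_
    have hlim : Tendsto (fun t => ‖(T * finProj b s) x - (T * finProj b t) x‖) atTop
        (𝓝 ‖(T * finProj b s) x - T x‖) :=
      (tendsto_const_nhds.sub ((T.continuous.tendsto _).comp (tendsto_finProj b x))).norm
    refine le_of_tendsto hlim ((eventually_ge_atTop s).mono fun t hst => ?_)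
    classical
    rw [happ, happ, norm_sub_rev, ← Finset.sum_sdiff hst, add_sub_cancel_right]
    calc ‖∑ i ∈ t \ s, ⟪b i, x⟫_ℂ • T (b i)‖
        ≤ ∑ i ∈ t \ s, ‖T (b i)‖ * ‖⟪b i, x⟫_ℂ‖ :=
          (norm_sum_le _ _).trans_eq (Finset.sum_congr rfl fun i _ => by rw [norm_smul, mul_comm])
      _ ≤ √(∑ i ∈ t \ s, ‖T (b i)‖ ^ 2) * √(∑ i ∈ t \ s, ‖⟪b i, x⟫_ℂ‖ ^ 2) :=
          Real.sum_mul_le_sqrt_mul_sqrt _ _ _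
      _ ≤ √(∑' i : {i // i ∉ s}, ‖T (b i)‖ ^ 2) * ‖x‖ := by
          gcongr
          · have hs : Summable fun i : {i // i ∉ s} => ‖T (b i)‖ ^ 2 := hsum.subtype _
            have := hs.sum_le_tsum ((t \ s).subtype fun i => i ∉ s) fun i _ => by positivity
            refine le_trans (le_of_eq ?_) this
            rw [Finset.sum_subtype_of_mem (fun i => ‖T (b i)‖ ^ 2)]
            intro i hi
            exact (Finset.mem_sdiff.1 hi).2
          · exact Real.sqrt_le_iff.2 ⟨norm_nonneg _,
              b.orthonormal.sum_inner_products_le x⟩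
  · have : ∀ i, IsCompactOperator (rankOne ℂ (T (b i)) (b i)) := fun i => by
      have h1 : IsCompactOperator (ContinuousLinearMap.toSpanSingleton ℂ (T (b i))) :=
        isCompactOperator_of_locallyCompactSpace_rng
          (ContinuousLinearMap.toSpanSingleton ℂ (T (b i)))
      exact h1.comp_clm (innerSL ℂ (b i))
    have e : T * finProj b s = ∑ i ∈ s, rankOne ℂ (T (b i)) (b i) := by
      simp [finProj, Finset.mul_sum, mul_rankOne]
    rw [e]
    exact Submodule.sum_mem (compactOperator (RingHom.id ℂ) H H) fun i _ => this i

end IsContrIdem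

end SchurHyper

namespace SchurHyper

open Filter Topology InnerProductSpace

theorem nonpos_of_forall_mul_le_sq {b c : ℝ} (h : ∀ t : ℝ, 0 < t → t * b ≤ t ^ 2 * c) : b ≤ 0 := by
  by_contra! hb
  have hc : 0 < |c| + 1 := by positivity
  have h1 := h (b / (|c| + 1)) (by positivity)
  have h2 : b ≤ b / (|c| + 1) * c := by
    rw [sq, mul_assoc] at h1
    exact le_of_mul_le_mul_left h1 (by positivity)
  rw [div_mul_eq_mul_div, le_div_iff₀ hc] at h2
  have := (le_of_mul_le_mul_left h2 hb)
  linarith [le_abs_self c]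

variable {H : Type*} [NormedAddCommGroup H] [InnerProductSpace ℂ H] [CompleteSpace H]
variable {D : StarSubalgebra ℂ (B H)} {Ψ : B H →L[ℂ] B H}

theorem star_inner_left (A : B H) (x y : H) : ⟪star A x, y⟫_ℂ = ⟪x, A y⟫_ℂ :=
  ContinuousLinearMap.adjoint_inner_left A y x

theorem star_inner_right (A : B H) (x y : H) : ⟪x, star A y⟫_ℂ = ⟪A x, y⟫_ℂ :=
  ContinuousLinearMap.adjoint_inner_right A x y

/-- The row `(T, (1 - T T*) C)` is contractive when `T` and `C` are. -/
theorem norm_add_sq_le_of_contraction {T C : B H} (hT : ‖T‖ ≤ 1) (hC : ‖C‖ ≤ 1) (p q : H) :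
    ‖T p + ((1 - T * star T) * C) q‖ ^ 2 ≤ ‖p‖ ^ 2 + ‖q‖ ^ 2 := by
  set z := T p + ((1 - T * star T) * C) q with hz
  set u := star T z with hu
  set w := z - T u with hw
  have hw2 : ‖w‖ ^ 2 + ‖u‖ ^ 2 ≤ ‖z‖ ^ 2 := by
    have h1 : ‖w‖ ^ 2 = ‖z‖ ^ 2 - 2 * RCLike.re ⟪z, T u⟫_ℂ + ‖T u‖ ^ 2 := norm_sub_sq _ _
    have h2 : RCLike.re ⟪z, T u⟫_ℂ = ‖u‖ ^ 2 := by
      rw [← star_inner_left, ← hu, inner_self_eq_norm_sq]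
    have h3 : ‖T u‖ ≤ ‖u‖ := by simpa using T.le_of_opNorm_le hT u
    have h4 : ‖T u‖ ^ 2 ≤ ‖u‖ ^ 2 := by gcongr
    linarith
  have h1 : ‖z‖ ^ 2 ≤ ‖u‖ * ‖p‖ + ‖w‖ * ‖q‖ := by
    have e : ⟪z, z⟫_ℂ = ⟪u, p⟫_ℂ + ⟪w, C q⟫_ℂ := by
      conv_lhs => rw [hz, ← hz, inner_add_right]
      rw [← star_inner_left, ← hu]
      congr 1
      have : ((1 - T * star T) * C) q = C q - T (star T (C q)) := rfl
      rw [this, inner_sub_right, ← star_inner_left T z, ← hu, hw, inner_sub_left, star_inner_right]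
    have h2 : ‖z‖ ^ 2 = RCLike.re (⟪u, p⟫_ℂ + ⟪w, C q⟫_ℂ) := by
      rw [← e, inner_self_eq_norm_sq]
    have h3 : ‖C q‖ ≤ ‖q‖ := by simpa using C.le_of_opNorm_le hC q
    rw [h2, map_add]
    refine add_le_add (re_inner_le_norm _ _) ((re_inner_le_norm _ _).trans ?_)
    gcongr
  nlinarith [sq_nonneg (‖u‖ - ‖p‖), sq_nonneg (‖w‖ - ‖q‖)]

namespace IsContrIdem

theorem norm_row_le (h : IsContrIdem D Ψ) {T C d₁ d₂ : B H} (hT : ‖T‖ ≤ 1) (hC : ‖C‖ ≤ 1)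
    (hΨ : Ψ T = T) (h₁ : d₁ ∈ D) (h₂ : d₂ ∈ D) {m : ℝ} (hm : 0 ≤ m)
    (hd : ∀ x, ‖d₁ x‖ ^ 2 + ‖d₂ x‖ ^ 2 ≤ m ^ 2 * ‖x‖ ^ 2) :
    ‖T * d₁ + Ψ ((1 - T * star T) * C) * d₂‖ ≤ m := by
  have e : T * d₁ + Ψ ((1 - T * star T) * C) * d₂
      = Ψ (T * d₁ + (1 - T * star T) * C * d₂) := by
    rw [map_add, h.mul_right h₁, h.mul_right h₂, hΨ]
  rw [e]
  refine (h.norm_le _).trans (ContinuousLinearMap.opNorm_le_bound _ hm fun x => ?_)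
  refine le_of_sq_le_sq ?_ (by positivity)
  rw [mul_pow]
  exact (norm_add_sq_le_of_contraction hT hC (d₁ x) (d₂ x)).trans (hd x)

theorem star_apply_eq_zero_aux (h : IsContrIdem D Ψ) (hD : IsMasa D) {T C : B H} (hT : ‖T‖ ≤ 1)
    (hC : ‖C‖ ≤ 1) (hΨ : Ψ T = T) {v : H} (hv : T (star T v) = v) :
    star (Ψ ((1 - T * star T) * C)) v = 0 := by
  set X := Ψ ((1 - T * star T) * C) with hX
  set f := star T v with hf
  set g := star X v with hg
  have hfv : ‖f‖ ^ 2 = ‖v‖ ^ 2 := by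
    have : ⟪f, f⟫_ℂ = ⟪v, v⟫_ℂ := by
      conv_lhs => rw [hf, star_inner_left, hv]
    rw [← inner_self_eq_norm_sq (𝕜 := ℂ), ← inner_self_eq_norm_sq (𝕜 := ℂ), this]
  have hTf : ⟪v, T f⟫_ℂ = ((‖v‖ ^ 2 : ℝ) : ℂ) := by
    rw [hv, inner_self_eq_norm_sq_to_K]
    simp
  have key : ∀ {d₁ d₂ : B H}, d₁ ∈ D → d₂ ∈ D → ∀ {m : ℝ}, 0 ≤ m →
      (∀ x, ‖d₁ x‖ ^ 2 + ‖d₂ x‖ ^ 2 ≤ m ^ 2 * ‖x‖ ^ 2) → ∀ x,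
      ‖⟪v, T (d₁ x)⟫_ℂ + ⟪g, d₂ x⟫_ℂ‖ ^ 2 ≤ ‖v‖ ^ 2 * (m ^ 2 * ‖x‖ ^ 2) := by
    intro d₁ d₂ h₁ h₂ m hm hd x
    have h1 := h.norm_row_le hT hC hΨ h₁ h₂ hm hd
    have h2 : ⟪v, T (d₁ x)⟫_ℂ + ⟪g, d₂ x⟫_ℂ = ⟪v, (T * d₁ + X * d₂) x⟫_ℂ := by
      rw [hg, star_inner_left, ← inner_add_right]
      rfl
    rw [h2, ← mul_pow, ← mul_pow]
    gcongr
    exact (norm_inner_le_norm _ _).trans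
      (by gcongr; exact ContinuousLinearMap.le_of_opNorm_le _ h1 x)
  have horth : ∀ d ∈ D, ⟪g, d f⟫_ℂ = 0 := by
    intro d hd
    set z := ⟪g, d f⟫_ℂ with hz
    by_cases hv0 : ‖v‖ = 0
    · have : g = 0 := by rw [hg, norm_eq_zero.1 hv0, map_zero]
      rw [hz, this, inner_zero_left]
    have ha : 0 < ‖v‖ ^ 2 := by positivity
    set d' : B H := (starRingEnd ℂ) z • d with hd'
    have hd'D : d' ∈ D := D.smul_mem hd _
    have hz' : ⟪g, d' f⟫_ℂ = ((‖z‖ ^ 2 : ℝ) : ℂ) := by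
      rw [hd', smul_apply, inner_smul_right, ← hz, Complex.conj_mul']
      norm_cast
    have hb : 2 * ‖v‖ ^ 2 * ‖z‖ ^ 2 ≤ 0 := by
      refine nonpos_of_forall_mul_le_sq (c := ‖v‖ ^ 4 * ‖d'‖ ^ 2) fun t ht => ?_
      have hm : √(1 + t ^ 2 * ‖d'‖ ^ 2) ^ 2 = 1 + t ^ 2 * ‖d'‖ ^ 2 :=
        Real.sq_sqrt (by positivity)
      have h1 := key (one_mem D) (D.smul_mem hd'D (t : ℂ)) (Real.sqrt_nonneg (1 + t ^ 2 * ‖d'‖ ^ 2))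
        (fun x => by
          have h2 : ‖((t : ℂ) • d') x‖ ≤ t * (‖d'‖ * ‖x‖) := by
            rw [smul_apply, norm_smul, Complex.norm_real, Real.norm_eq_abs, abs_of_pos ht]
            gcongr
            exact d'.le_opNorm x
          have h3 : ‖((t : ℂ) • d') x‖ ^ 2 ≤ (t * (‖d'‖ * ‖x‖)) ^ 2 := by gcongr
          rw [hm, one_apply_eq_self]
          linarith) f
      rw [hm, smul_apply, inner_smul_right, hz', one_apply_eq_self, hTf, hfv,
        ← Complex.ofReal_mul, ← Complex.ofReal_add, Complex.norm_real, Real.norm_eq_abs,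
        sq_abs] at h1
      nlinarith [sq_nonneg (t * ‖z‖ ^ 2)]
    have : ‖z‖ ^ 2 ≤ 0 := by nlinarith
    exact norm_eq_zero.1 (pow_eq_zero_iff (two_ne_zero) |>.1 (le_antisymm this (by positivity)))
  set K := cyclicSubspace D f with hK
  have hgK : g ∈ Kᗮ := by
    have : K ≤ LinearMap.ker (innerSL ℂ g).toLinearMap :=
      cyclicSubspace_le (innerSL ℂ g).isClosed_ker fun A hA => by simpa using horth A hA
    rw [Submodule.mem_orthogonal']
    exact fun u hu => by simpa using this hu
  have hKg : K.starProjection g = 0 := (Submodule.starProjection_apply_eq_zero_iff K).2 hgK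
  have hKf : K.starProjection f = f := starProjection_cyclic_self f
  have hgf : ⟪f, g⟫_ℂ = 0 := Submodule.inner_right_of_mem_orthogonal (self_mem_cyclicSubspace f) hgK
  have hb : 2 * ‖v‖ ^ 2 * ‖g‖ ^ 2 ≤ 0 := by
    refine nonpos_of_forall_mul_le_sq (c := ‖v‖ ^ 2 * ‖g‖ ^ 2) fun t ht => ?_
    have h1 := key (hD.cyclic_mem f) (sub_mem (one_mem D) (hD.cyclic_mem f)) zero_le_one
      (fun x => by
        have := Submodule.norm_sq_eq_add_norm_sq_starProjection x K
        rw [Submodule.starProjection_orthogonal'] at this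
        rw [this, one_pow, one_mul]) (f + (t : ℂ) • g)
    have e1 : K.starProjection (f + (t : ℂ) • g) = f := by
      rw [map_add, map_smul, hKg, hKf, smul_zero, add_zero]
    have e2 : (1 - K.starProjection) (f + (t : ℂ) • g) = (t : ℂ) • g := by
      rw [sub_apply, e1, one_apply_eq_self, add_sub_cancel_left]
    have e3 : ‖f + (t : ℂ) • g‖ ^ 2 = ‖v‖ ^ 2 + t ^ 2 * ‖g‖ ^ 2 := by
      rw [norm_add_sq (𝕜 := ℂ), inner_smul_right, hgf, hfv, norm_smul, Complex.norm_real,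
        mul_pow, Real.norm_eq_abs, sq_abs]
      simp
    rw [e1, e2, e3, hTf, inner_smul_right, inner_self_eq_norm_sq_to_K] at h1
    have e4 : ((‖v‖ ^ 2 : ℝ) : ℂ) + (t : ℂ) * ((‖g‖ : ℂ)) ^ 2
        = ((‖v‖ ^ 2 + t * ‖g‖ ^ 2 : ℝ) : ℂ) := by push_cast; ring
    erw [e4] at h1
    rw [Complex.norm_real, Real.norm_eq_abs, sq_abs] at h1
    nlinarith [sq_nonneg (t * ‖g‖ ^ 2)]
  by_cases hv0 : ‖v‖ = 0
  · rw [hg, norm_eq_zero.1 hv0, map_zero]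
  have ha : 0 < ‖v‖ ^ 2 := by positivity
  have : ‖g‖ ^ 2 ≤ 0 := by nlinarith
  exact norm_eq_zero.1 (pow_eq_zero_iff (two_ne_zero) |>.1 (le_antisymm this (by positivity)))

theorem star_apply_eq_zero (h : IsContrIdem D Ψ) (hD : IsMasa D) {T : B H} (hT : ‖T‖ ≤ 1)
    (hΨ : Ψ T = T) {v : H} (hv : T (star T v) = v) (C : B H) :
    star (Ψ ((1 - T * star T) * C)) v = 0 := by
  have hC : ‖((‖C‖⁻¹ : ℝ) : ℂ) • C‖ ≤ 1 := by
    rw [norm_smul, Complex.norm_real, norm_inv, norm_norm]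
    exact inv_mul_le_one
  have h1 := h.star_apply_eq_zero_aux hD hT hC hΨ hv
  rcases eq_or_ne C 0 with rfl | hC0
  · simp
  · have e : C = ((‖C‖ : ℝ) : ℂ) • (((‖C‖⁻¹ : ℝ) : ℂ) • C) := by
      rw [smul_smul, ← Complex.ofReal_mul, mul_inv_cancel₀ (norm_ne_zero_iff.2 hC0)]
      simp
    rw [e, mul_smul_comm, map_smul, star_smul, smul_apply, h1, smul_zero]

/-- The fixed space of `T T*` is invariant under the adjoints of the symbol operators, when `T` is a
contraction in the range of a contractive Schur idempotent. -/
theorem apply_star_symbolOp (h : IsContrIdem D Ψ) (hD : IsMasa D) {T : B H} (hT : ‖T‖ ≤ 1)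
    (hΨ : Ψ T = T) {v : H} (hv : T (star T v) = v) (y z : H) :
    T (star T (star (symbolOp Ψ y z) v)) = star (symbolOp Ψ y z) v := by
  refine ext_inner_right ℂ fun x => ?_
  have h1 := h.star_apply_eq_zero hD hT hΨ hv (rankOne ℂ x y)
  have h2 : ⟪v, symbolOp Ψ y z ((1 - T * star T) x)⟫_ℂ = 0 := by
    rw [symbolOp_apply, ← mul_rankOne, ← star_inner_left, h1, inner_zero_left]
  rw [← star_inner_left, sub_apply, inner_sub_right, sub_eq_zero] at h2
  have h3 := star_inner_left (star T) (star T (star (symbolOp Ψ y z) v)) x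
  rw [star_star, star_inner_left T] at h3
  exact h3.trans h2.symm

end IsContrIdem

end SchurHyper

namespace SchurHyper

open Filter Topology InnerProductSpace

/-- Commuting endomorphisms leaving invariant a common nonzero finite-dimensional subspace have a
joint eigenvector in it. -/
theorem exists_joint_eigenvector {V : Type*} [AddCommGroup V] [Module ℂ V]
    (S : Set (Module.End ℂ V)) (hS : ∀ A ∈ S, ∀ C ∈ S, ∀ x, A (C x) = C (A x))
    (W : Submodule ℂ V) [FiniteDimensional ℂ W] (hW : W ≠ ⊥) (hinv : ∀ A ∈ S, ∀ x ∈ W, A x ∈ W) :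
    ∃ v ∈ W, v ≠ 0 ∧ ∀ A ∈ S, ∃ μ : ℂ, A v = μ • v := by
  induction hn : Module.finrank ℂ W using Nat.strong_induction_on generalizing W with
  | _ n ih =>
    by_cases hall : ∀ A ∈ S, ∃ μ : ℂ, ∀ x ∈ W, A x = μ • x
    · obtain ⟨v, hvW, hv0⟩ := W.ne_bot_iff.1 hW
      refine ⟨v, hvW, hv0, fun A hA => ?_⟩
      obtain ⟨μ, hμ⟩ := hall A hA
      exact ⟨μ, hμ v hvW⟩
    · push Not at hall
      obtain ⟨A, hA, hAμ⟩ := hall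
      have : Nontrivial W := Submodule.nontrivial_iff_ne_bot.2 hW
      obtain ⟨μ, hμ⟩ := Module.End.exists_eigenvalue (A.restrict (hinv A hA))
      obtain ⟨w, hw⟩ := hμ.exists_hasEigenvector
      have hw1 : A w = μ • (w : V) := congrArg Subtype.val hw.apply_eq_smul
      have hw0 : (w : V) ≠ 0 := fun h0 => hw.2 (Subtype.ext h0)
      set W' : Submodule ℂ V := W ⊓ LinearMap.ker (A - μ • LinearMap.id) with hW'
      have hmem : ∀ x, x ∈ W' ↔ x ∈ W ∧ A x = μ • x := fun x => by
        simp [hW', sub_eq_zero]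
      have hlt : W' < W := by
        refine lt_of_le_of_ne inf_le_left fun heq => ?_
        obtain ⟨x, hx, hne⟩ := hAμ μ
        exact hne ((hmem x).1 (heq ▸ hx)).2
      have : FiniteDimensional ℂ W' := Submodule.finiteDimensional_of_le hlt.le
      obtain ⟨v, hv, hv0, h⟩ := ih _ (hn ▸ Submodule.finrank_lt_finrank_of_lt hlt) W'
        ((Submodule.ne_bot_iff _).2 ⟨w, (hmem _).2 ⟨w.2, hw1⟩, hw0⟩)
        (fun C hC x hx => by
          rw [hmem] at hx ⊢
          exact ⟨hinv C hC x hx.1, by rw [hS A hA C hC, hx.2, map_smul]⟩) rfl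
      exact ⟨v, hlt.le hv, hv0, h⟩

variable {H : Type*} [NormedAddCommGroup H] [InnerProductSpace ℂ H] [CompleteSpace H]
variable {D : StarSubalgebra ℂ (B H)} {Ψ : B H →L[ℂ] B H}

omit [CompleteSpace H] in
theorem eq_zero_or_eq_zero_of_mul_mul_eq_zero {A C : B H} (h : ∀ T : B H, A * T * C = 0) :
    A = 0 ∨ C = 0 := by
  by_contra! hne
  obtain ⟨x, hx⟩ := DFunLike.ne_iff.1 hne.1
  obtain ⟨z, hz⟩ := DFunLike.ne_iff.1 hne.2
  have h1 : (A * rankOne ℂ x (C z) * C) z = 0 := by rw [h]; rfl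
  rw [mul_rankOne] at h1
  change rankOne ℂ (A x) (C z) (C z) = 0 at h1
  rw [rankOne_apply, smul_eq_zero, inner_self_eq_zero] at h1
  exact h1.elim hz hx

theorem exists_apply_eq_self {E : B H} (hE : IsStarProjection E) (h0 : E ≠ 0) :
    ∃ v : H, ‖v‖ = 1 ∧ E v = v := by
  obtain ⟨x, hx⟩ := DFunLike.ne_iff.1 h0
  change E x ≠ 0 at hx
  refine ⟨((‖E x‖⁻¹ : ℝ) : ℂ) • E x, ?_, ?_⟩
  · rw [norm_smul, Complex.norm_real, norm_inv, norm_norm, inv_mul_cancel₀ (norm_ne_zero_iff.2 hx)]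
  · rw [map_smul]
    congr 1
    exact congrArg (fun S : B H => S x) hE.isIdempotentElem

/-- A compact contraction of norm one attains its norm. -/
theorem exists_apply_star_apply_eq {T : B H} (hc : IsCompactOperator T) (hT : ‖T‖ = 1) :
    ∃ v : H, v ≠ 0 ∧ T (star T v) = v := by
  have hA : IsCompactOperator (T * star T) := hc.comp_clm (star T)
  have hnorm : ‖T * star T‖ = 1 := by rw [CStarRing.norm_self_mul_star, hT, one_mul]
  have : Nontrivial (B H) := ⟨T, 0, fun h0 => by simp [h0] at hT⟩
  obtain ⟨μ, hμ, hμ1⟩ := spectrum.exists_nnnorm_eq_spectralRadius (T * star T)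
  rw [(IsSelfAdjoint.mul_star_self T).spectralRadius_eq_nnnorm, ENNReal.coe_inj] at hμ1
  have hμn : ‖μ‖ = 1 := by
    rw [← hnorm]
    exact congrArg NNReal.toReal hμ1
  have hμ0 : μ ≠ 0 := fun h0 => by simp [h0] at hμn
  obtain ⟨v, hv⟩ := ((hA.hasEigenvalue_iff_mem_spectrum hμ0).2 hμ).exists_hasEigenvector
  have hv1 : T (star T v) = μ • v := hv.apply_eq_smul
  have hv0 : ‖v‖ ≠ 0 := norm_ne_zero_iff.2 hv.2
  have h1 : μ * ((‖v‖ ^ 2 : ℝ) : ℂ) = ((‖star T v‖ ^ 2 : ℝ) : ℂ) := by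
    have h2 : ⟪v, T (star T v)⟫_ℂ = ⟪star T v, star T v⟫_ℂ := (star_inner_left T v _).symm
    rw [hv1, inner_smul_right, inner_self_eq_norm_sq_to_K, inner_self_eq_norm_sq_to_K] at h2
    simpa using h2
  have h2 : ‖v‖ ^ 2 = ‖star T v‖ ^ 2 := by
    have := congrArg norm h1
    rw [norm_mul, hμn, one_mul, Complex.norm_real, Complex.norm_real] at this
    simpa using this
  have h3 : μ = 1 := by
    rw [← h2] at h1
    exact mul_right_cancel₀ (Complex.ofReal_ne_zero.2 (pow_ne_zero 2 hv0))
      (h1.trans (one_mul _).symm)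
  exact ⟨v, hv.2, by rw [hv1, h3, one_smul]⟩

namespace IsContrIdem

/-- If the symbol operators are scalar on the range of `E`, then `E Ψ(T) = E T Q` for some
projection `Q`. -/
theorem exists_row_of_scalar (h : IsContrIdem D Ψ) (hD : IsMasa D) {E : B H}
    (hE : IsStarProjection E) (h0 : E ≠ 0)
    (hs : ∀ y z, ∃ μ : ℂ, E * symbolOp Ψ y z = μ • E) :
    ∃ Q ∈ D, IsStarProjection Q ∧ ∀ T, E * Ψ T = E * T * Q := by
  obtain ⟨v, hv1, hv⟩ := exists_apply_eq_self hE h0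
  have hS := h.conj.symbolOp_mem hD v v
  set S := symbolOp (conjMap Ψ) v v with hSdef
  have hSv : ∀ y z, ⟪y, star S z⟫_ℂ = ⟪v, Ψ (rankOne ℂ v y) z⟫_ℂ := by
    intro y z
    rw [star_inner_right, hSdef, symbolOp_apply, conjMap_apply, star_inner_left, star_rankOne]
  have hsc : ∀ y z, E * symbolOp Ψ y z = ⟪y, star S z⟫_ℂ • E := by
    intro y z
    obtain ⟨μ, hμ⟩ := hs y z
    rw [hμ, hSv]
    congr 1
    have h1 : E (symbolOp Ψ y z v) = μ • v := by
      have := congrArg (fun A : B H => A v) hμ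
      simpa [hv] using this
    have h2 : ⟪v, E (symbolOp Ψ y z v)⟫_ℂ = ⟪v, symbolOp Ψ y z v⟫_ℂ := by
      rw [← star_inner_left, hE.isSelfAdjoint.star_eq, hv]
    rw [h1, inner_smul_right, inner_self_eq_norm_sq_to_K, hv1] at h2
    simpa using h2
  have hrow : ∀ T, E * Ψ T = E * T * star S := by
    intro T
    have := h.eq_of_rankOne E 1 E (star S) (fun x y => ?_) T
    · simpa using this
    · ext z
      have := congrArg (fun A : B H => A x) (hsc y z)
      simpa [mul_rankOne] using this
  refine ⟨star S, star_mem hS,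
    ContinuousLinearMap.isStarProjection_iff_isIdempotentElem_and_isStarNormal.2
      ⟨?_, ⟨hD.1 _ (star_mem (star_mem hS)) _ (star_mem hS)⟩⟩, hrow⟩
  have h2 : ∀ y z, ⟪y, (star S * star S) z⟫_ℂ = ⟪y, star S z⟫_ℂ := by
    intro y z
    have e : E * rankOne ℂ v y * star S * star S = E * rankOne ℂ v y * star S := by
      have := hrow (Ψ (rankOne ℂ v y))
      rw [h.idem, hrow] at this
      exact this.symm
    rw [mul_rankOne, hv] at e
    have := congrArg (fun A : B H => A z) e
    change ⟪y, star S (star S z)⟫_ℂ • v = ⟪y, star S z⟫_ℂ • v at this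
    have hv0 : v ≠ 0 := fun h0 => by simp [h0] at hv1
    exact smul_left_injective ℂ hv0 this
  exact ContinuousLinearMap.ext fun z => ext_inner_left ℂ fun y => h2 y z

/-- Row structure of a contractive Schur idempotent on the cyclic subspace of a joint
eigenvector. -/
theorem exists_row_of_eigenvector (h : IsContrIdem D Ψ) (hD : IsMasa D) {v : H} (hv0 : v ≠ 0)
    (hv : ∀ y z, ∃ μ : ℂ, star (symbolOp Ψ y z) v = μ • v) :
    ∃ Q ∈ D, IsStarProjection Q ∧ ∀ T, (cyclicSubspace D v).starProjection * Ψ T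
      = (cyclicSubspace D v).starProjection * T * Q := by
  have hE : IsStarProjection (cyclicSubspace D v).starProjection := isStarProjection_starProjection
  refine h.exists_row_of_scalar hD hE (fun h0 => hv0 ?_) fun y z => ?_
  · rw [← starProjection_cyclic_self (D := D) v, h0]
    rfl
  · obtain ⟨μ, hμ⟩ := hv y z
    have h1 := mul_starProjection_cyclic_eq (D := D) (Z := star (symbolOp Ψ y z)) (W := μ • 1)
      (x := v) fun A hA => by
        have h2 := hD.1 _ (star_mem (h.symbolOp_mem hD y z)) A hA
        have h3 : star (symbolOp Ψ y z) (A v) = A (star (symbolOp Ψ y z) v) :=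
          congrArg (fun C : B H => C v) h2
        rw [h3, hμ]
        simp
    have h2 := congrArg star h1
    rw [star_mul, star_mul, star_star, hE.isSelfAdjoint.star_eq] at h2
    exact ⟨star μ, by simpa using h2⟩

/-- Where a contractive Schur idempotent is nonzero, it contains a row `E Ψ(T) = E T Q`. -/
theorem exists_row (h : IsContrIdem D Ψ) (hD : IsMasa D) {R : B H} (hR : IsStarProjection R)
    (hRD : R ∈ D) (hne : ∃ T, R * Ψ T ≠ 0) :
    ∃ v : H, v ≠ 0 ∧ R v = v ∧ ∃ E ∈ D, IsStarProjection E ∧ E v = v ∧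
      ∃ Q ∈ D, IsStarProjection Q ∧ Q ≠ 0 ∧ ∀ T, E * Ψ T = E * T * Q := by
  obtain ⟨k, y, hky⟩ : ∃ k y : H, R * Ψ (rankOne ℂ k y) ≠ 0 := by
    by_contra! hall
    obtain ⟨T, hT⟩ := hne
    apply hT
    have := h.eq_of_rankOne R 1 0 0 (fun x y => by simp [hall]) T
    simpa using this
  rw [← h.mul_left hRD, mul_rankOne] at hky
  set T₁ := Ψ (rankOne ℂ (R k) y) with hT₁
  have hRT₁ : R * T₁ = T₁ := by
    rw [hT₁, ← h.mul_left hRD, mul_rankOne]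
    exact congrArg (fun S : B H => Ψ (rankOne ℂ (S k) y)) hR.isIdempotentElem
  set T : B H := ((‖T₁‖⁻¹ : ℝ) : ℂ) • T₁ with hT
  have hT1 : ‖T‖ = 1 := by
    rw [hT, norm_smul, Complex.norm_real, norm_inv, norm_norm,
      inv_mul_cancel₀ (norm_ne_zero_iff.2 hky)]
  have hRT : R * T = T := by rw [hT, mul_smul_comm, hRT₁]
  have hΨ : Ψ T = T := by rw [hT, map_smul, hT₁, h.idem]
  have hTc : IsCompactOperator T := (h.isCompactOperator_rankOne hD (R k) y).smul _
  obtain ⟨w, hw0, hw⟩ := exists_apply_star_apply_eq hTc hT1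
  have hAc : IsCompactOperator (T * star T) := hTc.comp_clm (star T)
  have hfd := ContinuousLinearMap.finite_dimensional_eigenspace hAc 1 one_ne_zero
  set W := Module.End.eigenspace (T * star T).toLinearMap (1 : ℂ) with hW
  have hmem : ∀ x, x ∈ W ↔ T (star T x) = x := fun x => by
    rw [hW, Module.End.mem_eigenspace_iff, one_smul]
    rfl
  obtain ⟨v, hvW, hv0, hv⟩ := exists_joint_eigenvector
    {A : Module.End ℂ H | ∃ y z, A = (star (symbolOp Ψ y z)).toLinearMap}
    (by
      rintro _ ⟨y, z, rfl⟩ _ ⟨y', z', rfl⟩ x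
      exact congrArg (fun C : B H => C x) (hD.1 _ (star_mem (h.symbolOp_mem hD y z)) _
        (star_mem (h.symbolOp_mem hD y' z'))))
    W ((Submodule.ne_bot_iff _).2 ⟨w, (hmem w).2 hw, hw0⟩)
    (by
      rintro _ ⟨y, z, rfl⟩ x hx
      exact (hmem _).2 (h.apply_star_symbolOp hD hT1.le hΨ ((hmem x).1 hx) y z))
  have hTv := (hmem v).1 hvW
  obtain ⟨Q, hQD, hQ, hrow⟩ := h.exists_row_of_eigenvector hD hv0 fun y z => hv _ ⟨y, z, rfl⟩
  refine ⟨v, hv0, ?_, _, hD.cyclic_mem v, isStarProjection_starProjection,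
    starProjection_cyclic_self v, Q, hQD, hQ, ?_, hrow⟩
  · rw [← hTv]
    exact congrArg (fun S : B H => S (star T v)) hRT
  · rintro rfl
    have h1 := hrow T
    rw [hΨ, mul_zero] at h1
    have h2 := congrArg (fun S : B H => S (star T v)) h1
    change (cyclicSubspace D v).starProjection (T (star T v)) = 0 at h2
    rw [hTv, starProjection_cyclic_self] at h2
    exact hv0 h2

/-- A full corner extends to a row. -/
theorem exists_row_of_full (h : IsContrIdem D Ψ) (hD : IsMasa D) {E F : B H}
    (hE : IsStarProjection E) (hED : E ∈ D) (hE0 : E ≠ 0) (hF : IsStarProjection F) (hFD : F ∈ D)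
    (hF0 : F ≠ 0) (hfull : ∀ T, E * Ψ T * F = E * T * F) :
    ∃ Q ∈ D, IsStarProjection Q ∧ ∀ T, E * Ψ T = E * T * Q := by
  obtain ⟨f, hf1, hf⟩ := exists_apply_eq_self hF hF0
  refine h.exists_row_of_scalar hD hE hE0 fun y z => ?_
  have hunit : ∀ v, ‖v‖ = 1 → E v = v → ∃ μ : ℂ, star (symbolOp Ψ y z) v = μ • v := by
    intro v hv1 hv
    have e : E * rankOne ℂ v f * F = rankOne ℂ v f := by
      rw [mul_rankOne, rankOne_mul, hF.isSelfAdjoint.star_eq, hv, hf]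
    have h1 : Ψ (rankOne ℂ v f) = rankOne ℂ v f := by
      rw [← e, h.bimod E hED F hFD, hfull]
    have h2 : ∀ x, rankOne ℂ v f (star (rankOne ℂ v f) x) = ⟪v, x⟫_ℂ • v := by
      intro x
      rw [star_rankOne, rankOne_apply, rankOne_apply, inner_smul_right,
        inner_self_eq_norm_sq_to_K, hf1]
      simp
    have h3 := h.apply_star_symbolOp hD (T := rankOne ℂ v f)
      (by rw [norm_rankOne, hv1, hf1, one_mul])
      h1 (v := v) (by rw [h2, inner_self_eq_norm_sq_to_K, hv1]; simp) y z
    rw [h2] at h3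
    exact ⟨_, h3.symm⟩
  have hall : ∀ v, E v = v → ∃ μ : ℂ, star (symbolOp Ψ y z) v = μ • v := by
    intro v hv
    rcases eq_or_ne v 0 with rfl | hv0
    · exact ⟨0, by simp⟩
    obtain ⟨μ, hμ⟩ := hunit (((‖v‖⁻¹ : ℝ) : ℂ) • v)
      (by rw [norm_smul, Complex.norm_real, norm_inv, norm_norm,
        inv_mul_cancel₀ (norm_ne_zero_iff.2 hv0)]) (by rw [map_smul, hv])
    refine ⟨μ, ?_⟩
    rw [map_smul, smul_comm] at hμ
    have hc : ((‖v‖⁻¹ : ℝ) : ℂ) ≠ 0 :=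
      Complex.ofReal_ne_zero.2 (inv_ne_zero (norm_ne_zero_iff.2 hv0))
    exact smul_right_injective _ hc hμ
  set K : Submodule ℂ H := LinearMap.ker (E - 1).toLinearMap with hK
  have hmem : ∀ x, x ∈ K ↔ E x = x := fun x => by simp [hK, sub_eq_zero]
  have hinv : ∀ x ∈ K, star (symbolOp Ψ y z) x ∈ K := by
    intro x hx
    obtain ⟨μ, hμ⟩ := hall x ((hmem x).1 hx)
    rw [hμ]
    exact K.smul_mem _ hx
  obtain ⟨μ, hμ⟩ := LinearMap.exists_eq_smul_id_of_forall_notLinearIndependent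
    (f := (star (symbolOp Ψ y z)).toLinearMap.restrict hinv) fun x hx => by
      obtain ⟨μ, hμ⟩ := hall x ((hmem x).1 x.2)
      have := LinearIndependent.pair_iff.1 hx (-μ) 1 (Subtype.ext (by simp [hμ]))
      exact one_ne_zero this.2
  have h1 : star (symbolOp Ψ y z) * E = μ • E := by
    ext x
    have hx : E x ∈ K := (hmem _).2 (congrArg (fun S : B H => S x) hE.isIdempotentElem)
    exact congrArg (fun g : K →ₗ[ℂ] K => ((g ⟨E x, hx⟩ : K) : H)) hμ
  have h2 := congrArg star h1
  rw [star_mul, star_star, hE.isSelfAdjoint.star_eq] at h2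
  exact ⟨star μ, by simpa [hE.isSelfAdjoint.star_eq] using h2⟩

/-- A full corner extends to a column. -/
theorem exists_column_of_full (h : IsContrIdem D Ψ) (hD : IsMasa D) {E F : B H}
    (hE : IsStarProjection E) (hED : E ∈ D) (hE0 : E ≠ 0) (hF : IsStarProjection F) (hFD : F ∈ D)
    (hF0 : F ≠ 0) (hfull : ∀ T, E * Ψ T * F = E * T * F) :
    ∃ P ∈ D, IsStarProjection P ∧ ∀ T, Ψ T * F = P * T * F := by
  obtain ⟨P, hPD, hP, hrow⟩ := h.conj.exists_row_of_full hD hF hFD hF0 hE hED hE0 fun T => by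
    have := congrArg star (hfull (star T))
    simpa [mul_assoc, hE.isSelfAdjoint.star_eq, hF.isSelfAdjoint.star_eq] using this
  refine ⟨P, hPD, hP, fun T => ?_⟩
  have := congrArg star (hrow (star T))
  simpa [mul_assoc, hP.isSelfAdjoint.star_eq, hF.isSelfAdjoint.star_eq] using this

end IsContrIdem

/-- A maximal full block of a Schur idempotent. -/
structure IsComponent (D : StarSubalgebra ℂ (B H)) (Ψ : B H →L[ℂ] B H) (P Q : B H) : Prop where
  left_mem : P ∈ D
  right_mem : Q ∈ D
  left_proj : IsStarProjection P
  right_proj : IsStarProjection Q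
  left_ne : P ≠ 0
  right_ne : Q ≠ 0
  row : ∀ T, P * Ψ T = P * T * Q
  column : ∀ T, Ψ T * Q = P * T * Q

theorem IsContrIdem.exists_component (h : IsContrIdem D Ψ) (hD : IsMasa D) {R : B H}
    (hR : IsStarProjection R) (hRD : R ∈ D) (hne : ∃ T, R * Ψ T ≠ 0) :
    ∃ P Q, IsComponent D Ψ P Q ∧ P * R ≠ 0 := by
  obtain ⟨v, hv0, hRv, E, hED, hE, hEv, Q, hQD, hQ, hQ0, hrow⟩ := h.exists_row hD hR hRD hne
  have hE0 : E ≠ 0 := by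
    rintro rfl
    exact hv0 hEv.symm
  obtain ⟨P, hPD, hP, hcol⟩ := h.exists_column_of_full hD hE hED hE0 hQ hQD hQ0 fun T => by
    rw [hrow, mul_assoc _ Q, hQ.isIdempotentElem.eq]
  have hEP : E = E * P := by
    have := (eq_zero_or_eq_zero_of_mul_mul_eq_zero (A := E - E * P) (C := Q) fun T => by
      rw [sub_mul, sub_mul, mul_assoc E P, mul_assoc E (P * T), ← hcol, ← mul_assoc, hrow,
        mul_assoc _ Q, hQ.isIdempotentElem.eq, sub_self]).resolve_right hQ0
    exact sub_eq_zero.1 this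
  have hP0 : P ≠ 0 := by
    rintro rfl
    exact hE0 (by rw [hEP, mul_zero])
  obtain ⟨Q', hQ'D, hQ', hrow'⟩ := h.exists_row_of_full hD hP hPD hP0 hQ hQD hQ0 fun T => by
    rw [mul_assoc, hcol, ← mul_assoc, ← mul_assoc, hP.isIdempotentElem.eq]
  have hQQ' : Q = Q' := by
    have := (eq_zero_or_eq_zero_of_mul_mul_eq_zero (A := E) (C := Q - Q') fun T => by
      have e : E * T * Q' = E * T * Q := by
        calc E * T * Q' = E * (P * T * Q') := by rw [← mul_assoc, ← mul_assoc, ← hEP]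
          _ = E * T * Q := by rw [← hrow', ← mul_assoc, ← hEP, hrow]
      rw [mul_sub, e, sub_self]).resolve_left hE0
    exact sub_eq_zero.1 this
  subst hQQ'
  refine ⟨P, Q, ⟨hPD, hQD, hP, hQ, hP0, hQ0, hrow', hcol⟩, fun h0 => hv0 ?_⟩
  have h1 : P (R v) = 0 := congrArg (fun S : B H => S v) h0
  rw [hRv] at h1
  rw [← hEv, hEP]
  change E (P v) = 0
  rw [h1, map_zero]

end SchurHyper

namespace SchurHyper

open Filter Topology InnerProductSpace

variable {H : Type*} [NormedAddCommGroup H] [InnerProductSpace ℂ H] [CompleteSpace H]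
variable {D : StarSubalgebra ℂ (B H)} {Ψ : B H →L[ℂ] B H} {ι : Type*} {p : ι → B H}

theorem norm_sq_apply_of_isStarProjection {P : B H} (hP : IsStarProjection P) (z : H) :
    ‖P z‖ ^ 2 = RCLike.re ⟪z, P z⟫_ℂ := by
  have h : P (P z) = P z := congrArg (fun S : B H => S z) hP.isIdempotentElem
  rw [← inner_self_eq_norm_sq (𝕜 := ℂ), ← star_inner_right, hP.isSelfAdjoint.star_eq, h,
    ← star_inner_left, hP.isSelfAdjoint.star_eq]

/-- A family of mutually orthogonal projections. -/
structure OrthogonalProjections (p : ι → B H) : Prop where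
  proj : ∀ i, IsStarProjection (p i)
  mul_eq_zero : ∀ i j, i ≠ j → p i * p j = 0

namespace OrthogonalProjections

theorem sum_mul_sum (hp : OrthogonalProjections p) {s t : Finset ι} (hst : s ⊆ t) :
    (∑ i ∈ t, p i) * ∑ i ∈ s, p i = ∑ i ∈ s, p i := by
  rw [Finset.mul_sum]
  refine Finset.sum_congr rfl fun i hi => ?_
  rw [Finset.sum_mul, Finset.sum_eq_single_of_mem i (hst hi) fun j _ hj => hp.mul_eq_zero j i hj,
    (hp.proj i).isIdempotentElem.eq]

theorem mul_sum_of_mem (hp : OrthogonalProjections p) {s : Finset ι} {i : ι} (hi : i ∈ s) :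
    p i * ∑ j ∈ s, p j = p i := by
  rw [Finset.mul_sum, Finset.sum_eq_single_of_mem i hi fun j _ hj => hp.mul_eq_zero i j hj.symm,
    (hp.proj i).isIdempotentElem.eq]

theorem isStarProjection_sum (hp : OrthogonalProjections p) (s : Finset ι) :
    IsStarProjection (∑ i ∈ s, p i) :=
  ⟨hp.sum_mul_sum subset_rfl, by
    rw [IsSelfAdjoint, star_sum]
    exact Finset.sum_congr rfl fun i _ => (hp.proj i).isSelfAdjoint.star_eq⟩

theorem norm_sum_sq (hp : OrthogonalProjections p) (s : Finset ι) (z : H) :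
    ‖(∑ i ∈ s, p i) z‖ ^ 2 = ∑ i ∈ s, ‖p i z‖ ^ 2 := by
  rw [norm_sq_apply_of_isStarProjection (hp.isStarProjection_sum s), sum_apply, inner_sum, map_sum]
  exact Finset.sum_congr rfl fun i _ => (norm_sq_apply_of_isStarProjection (hp.proj i) z).symm

end OrthogonalProjections

/-- The closed linear span of the ranges of finite sums of a family of projections. -/
def supportSpace (p : ι → B H) : Submodule ℂ H :=
  (⨆ s : Finset ι, LinearMap.ker (1 - ∑ i ∈ s, p i).toLinearMap).topologicalClosure

instance (p : ι → B H) : (supportSpace p).HasOrthogonalProjection := by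
  have : CompleteSpace (supportSpace p) :=
    (Submodule.isClosed_topologicalClosure _).completeSpace_coe
  infer_instance

/-- The supremum of a family of orthogonal projections. -/
def supportProj (p : ι → B H) : B H := (supportSpace p).starProjection

theorem isStarProjection_supportProj (p : ι → B H) : IsStarProjection (supportProj p) :=
  isStarProjection_starProjection

omit [CompleteSpace H] in
theorem mem_supportSpace_of_apply_eq {y : H} (s : Finset ι) (h : (∑ i ∈ s, p i) y = y) :
    y ∈ supportSpace p :=
  Submodule.le_topologicalClosure _ (Submodule.mem_iSup_of_mem s (by
    change y - (∑ i ∈ s, p i) y = 0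
    rw [h, sub_self]))

omit [CompleteSpace H] in
theorem supportSpace_le {K : Submodule ℂ H} (hK : IsClosed (K : Set H))
    (h : ∀ (s : Finset ι) y, (∑ i ∈ s, p i) y = y → y ∈ K) : supportSpace p ≤ K := by
  refine Submodule.topologicalClosure_minimal _ (iSup_le fun s y hy => h s y ?_) hK
  exact (sub_eq_zero.1 (show y - (∑ i ∈ s, p i) y = 0 from hy)).symm

theorem IsMasa.supportProj_mem (hD : IsMasa D) (hp : ∀ i, p i ∈ D) : supportProj p ∈ D := by
  refine hD.starProjection_mem _ fun A hA x hx => ?_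
  have : supportSpace p ≤ (supportSpace p).comap A.toLinearMap :=
    supportSpace_le ((Submodule.isClosed_topologicalClosure _).preimage A.continuous)
      fun s y hy => mem_supportSpace_of_apply_eq s (by
        have := hD.1 _ (sum_mem fun i (_ : i ∈ s) => hp i) A hA
        have := congrArg (fun S : B H => S y) this
        change (∑ i ∈ s, p i) (A y) = A ((∑ i ∈ s, p i) y) at this
        rwa [hy] at this)
  exact this hx

namespace OrthogonalProjections

theorem supportProj_mul_eq_zero (hp : OrthogonalProjections p) {Z : B H} (h : ∀ i, p i * Z = 0) :
    supportProj p * Z = 0 := by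
  ext x
  refine (Submodule.starProjection_apply_eq_zero_iff _).2 ?_
  rw [Submodule.mem_orthogonal']
  intro u hu
  have : supportSpace p ≤ LinearMap.ker (innerSL ℂ (Z x)).toLinearMap := by
    refine supportSpace_le (innerSL ℂ (Z x)).isClosed_ker fun s y hy => ?_
    change ⟪Z x, y⟫_ℂ = 0
    rw [← hy, ← star_inner_left, (hp.isStarProjection_sum s).isSelfAdjoint.star_eq]
    change ⟪((∑ i ∈ s, p i) * Z) x, y⟫_ℂ = 0
    rw [Finset.sum_mul, Finset.sum_eq_zero fun i _ => h i]
    simp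
  exact this hu

theorem supportProj_mul (hp : OrthogonalProjections p) (i : ι) : supportProj p * p i = p i := by
  ext x
  refine Submodule.starProjection_eq_self_iff.2 (mem_supportSpace_of_apply_eq {i} ?_)
  rw [Finset.sum_singleton]
  exact congrArg (fun S : B H => S x) (hp.proj i).isIdempotentElem

theorem mul_supportProj (hp : OrthogonalProjections p) (i : ι) : p i * supportProj p = p i := by
  have := congrArg star (hp.supportProj_mul i)
  rwa [star_mul, (hp.proj i).isSelfAdjoint.star_eq,
    (isStarProjection_supportProj p).isSelfAdjoint.star_eq] at this

theorem norm_supportProj_apply_le (hp : OrthogonalProjections p) {z : H} {C : ℝ}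
    (h : ∀ s : Finset ι, ‖(∑ i ∈ s, p i) z‖ ≤ C) : ‖supportProj p z‖ ≤ C := by
  classical
  refine le_of_forall_pos_le_add fun ε hε => ?_
  have hmem : supportProj p z ∈ supportSpace p := Submodule.starProjection_apply_mem _ _
  obtain ⟨y, hy, hdist⟩ := Metric.mem_closure_iff.1 hmem (ε / 2) (by positivity)
  have hdir : Directed (· ≤ ·)
      fun s : Finset ι => LinearMap.ker (1 - ∑ i ∈ s, p i).toLinearMap := by
    refine Monotone.directed_le fun s t hst x hx => ?_
    have hx' : (∑ i ∈ s, p i) x = x :=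
      (sub_eq_zero.1 (show x - (∑ i ∈ s, p i) x = 0 from hx)).symm
    change x - (∑ i ∈ t, p i) x = 0
    have := congrArg (fun S : B H => S x) (hp.sum_mul_sum hst)
    change (∑ i ∈ t, p i) ((∑ i ∈ s, p i) x) = (∑ i ∈ s, p i) x at this
    rw [hx'] at this
    rw [this, sub_self]
  obtain ⟨s, hs⟩ := (Submodule.mem_iSup_of_directed _ hdir).1 hy
  have hs' : (∑ i ∈ s, p i) y = y :=
    (sub_eq_zero.1 (show y - (∑ i ∈ s, p i) y = 0 from hs)).symm
  have h1 : (∑ i ∈ s, p i) (supportProj p z) = (∑ i ∈ s, p i) z := by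
    have : (∑ i ∈ s, p i) * supportProj p = ∑ i ∈ s, p i := by
      rw [Finset.sum_mul]
      exact Finset.sum_congr rfl fun i _ => hp.mul_supportProj i
    exact congrArg (fun S : B H => S z) this
  have h2 : ‖(∑ i ∈ s, p i) (y - supportProj p z)‖ ≤ ‖y - supportProj p z‖ := by
    simpa using ContinuousLinearMap.le_of_opNorm_le _ (hp.isStarProjection_sum s).norm_le
      (y - supportProj p z)
  rw [map_sub, hs', h1] at h2
  rw [dist_eq_norm, norm_sub_rev] at hdist
  have h3 : ‖y‖ ≤ ‖y - (∑ i ∈ s, p i) z‖ + ‖(∑ i ∈ s, p i) z‖ := by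
    simpa using norm_add_le (y - (∑ i ∈ s, p i) z) ((∑ i ∈ s, p i) z)
  have h4 : ‖supportProj p z‖ ≤ ‖y‖ + ‖y - supportProj p z‖ := by
    simpa using norm_sub_le y (y - supportProj p z)
  linarith [h s]

end OrthogonalProjections

/-- Summing a bilinear expression over pairs of complementary subsets recovers its off-diagonal
part. -/
theorem four_mul_sum_powerset {R : Type*} [Ring R] [DecidableEq ι] (p q : ι → R) (T : R)
    (s : Finset ι) :
    4 * ∑ ε ∈ s.powerset, (∑ i ∈ ε, p i) * T * (∑ i ∈ s, q i - ∑ i ∈ ε, q i)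
      = 2 ^ s.card * ((∑ i ∈ s, p i) * T * (∑ i ∈ s, q i) - ∑ i ∈ s, p i * T * q i) := by
  have hcount : ∀ (f : ι → R) (s : Finset ι),
      2 * ∑ ε ∈ s.powerset, ∑ i ∈ ε, f i = 2 ^ s.card * ∑ i ∈ s, f i := by
    intro f s
    induction s using Finset.induction_on with
    | empty => simp
    | insert a s ha ih =>
      rw [Finset.sum_powerset_insert ha, Finset.card_insert_of_notMem ha, Finset.sum_insert ha]
      have : ∑ ε ∈ s.powerset, ∑ i ∈ insert a ε, f i
          = ∑ ε ∈ s.powerset, (f a + ∑ i ∈ ε, f i) :=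
        Finset.sum_congr rfl fun ε hε => Finset.sum_insert fun h => ha (Finset.mem_powerset.1 hε h)
      rw [this, Finset.sum_add_distrib, Finset.sum_const, Finset.card_powerset, nsmul_eq_mul]
      push_cast
      rw [mul_add, mul_add, ih, pow_succ, mul_add]
      noncomm_ring
  induction s using Finset.induction_on with
  | empty => simp
  | insert a s ha ih =>
    have hmem : ∀ (f : ι → R), ∀ ε ∈ s.powerset, ∑ i ∈ insert a ε, f i = f a + ∑ i ∈ ε, f i :=
      fun f ε hε => Finset.sum_insert fun h => ha (Finset.mem_powerset.1 hε h)
    have key : ∑ ε ∈ (insert a s).powerset,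
          (∑ i ∈ ε, p i) * T * (∑ i ∈ insert a s, q i - ∑ i ∈ ε, q i)
        = 2 * (∑ ε ∈ s.powerset, (∑ i ∈ ε, p i) * T * (∑ i ∈ s, q i - ∑ i ∈ ε, q i))
          + (∑ ε ∈ s.powerset, ∑ i ∈ ε, p i) * T * q a
          + p a * T * (2 ^ s.card * ∑ i ∈ s, q i - ∑ ε ∈ s.powerset, ∑ i ∈ ε, q i) := by
      have hconst : (2 : R) ^ s.card * ∑ i ∈ s, q i = ∑ ε ∈ s.powerset, ∑ i ∈ s, q i := by
        rw [Finset.sum_const, Finset.card_powerset, nsmul_eq_mul]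
        push_cast
        rfl
      rw [Finset.sum_powerset_insert ha, hconst, ← Finset.sum_sub_distrib, Finset.mul_sum,
        Finset.mul_sum, Finset.sum_mul, Finset.sum_mul, ← Finset.sum_add_distrib,
        ← Finset.sum_add_distrib, ← Finset.sum_add_distrib]
      refine Finset.sum_congr rfl fun ε hε => ?_
      rw [hmem p ε hε, hmem q ε hε, Finset.sum_insert ha]
      noncomm_ring
    rw [key, Finset.card_insert_of_notMem ha, Finset.sum_insert ha, Finset.sum_insert ha,
      Finset.sum_insert ha, pow_succ]
    have hp := hcount p s
    have hq := hcount q s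
    have hN : ∀ x : R, x * 2 ^ s.card = 2 ^ s.card * x := fun x => by
      simpa using (Nat.cast_comm (2 ^ s.card) x).symm
    generalize (2 : R) ^ s.card = N at *
    generalize ∑ ε ∈ s.powerset, ∑ i ∈ ε, p i = A at *
    generalize ∑ ε ∈ s.powerset, ∑ i ∈ ε, q i = C at *
    generalize ∑ i ∈ s, p i = P at *
    generalize ∑ i ∈ s, q i = Q at *
    calc _ = 2 * (4 * (∑ ε ∈ s.powerset, (∑ i ∈ ε, p i) * T * (Q - ∑ i ∈ ε, q i)))
          + 2 * ((2 * A) * T * q a) + 4 * (p a * T * N * Q) - 2 * (p a * T * (2 * C)) := by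
            noncomm_ring
      _ = _ := by
        rw [ih, hp, hq, ← mul_assoc (p a * T), hN (p a * T)]
        noncomm_ring

end SchurHyper

namespace SchurHyper

open Filter Topology InnerProductSpace

variable {H : Type*} [NormedAddCommGroup H] [InnerProductSpace ℂ H] [CompleteSpace H]
variable {D : StarSubalgebra ℂ (B H)} {Ψ : B H →L[ℂ] B H}

theorem IsComponent.right_eq {P Q P' Q' : B H} (h : IsComponent D Ψ P Q)
    (h' : IsComponent D Ψ P' Q') (hD : IsMasa D) (hne : P * P' ≠ 0) : Q = Q' := by
  refine sub_eq_zero.1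
    ((eq_zero_or_eq_zero_of_mul_mul_eq_zero (A := P * P') fun T => ?_).resolve_left hne)
  have hc := hD.1 _ h.left_mem _ h'.left_mem
  calc P * P' * T * (Q - Q') = P' * (P * T * Q) - P * (P' * T * Q') := by
        rw [mul_sub]
        nth_rw 1 [hc]
        simp only [mul_assoc]
    _ = 0 := by
        rw [← h.row, ← h'.row, ← mul_assoc, ← mul_assoc, hc, sub_self]

theorem IsComponent.left_eq {P Q P' Q' : B H} (h : IsComponent D Ψ P Q)
    (h' : IsComponent D Ψ P' Q') (hD : IsMasa D) (hne : Q * Q' ≠ 0) : P = P' := by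
  refine sub_eq_zero.1
    ((eq_zero_or_eq_zero_of_mul_mul_eq_zero (C := Q * Q') fun T => ?_).resolve_right hne)
  have hc := hD.1 _ h.right_mem _ h'.right_mem
  calc (P - P') * T * (Q * Q') = (P * T * Q) * Q' - (P' * T * Q') * Q := by
        rw [sub_mul, sub_mul]
        nth_rw 2 [hc]
        simp only [mul_assoc]
    _ = 0 := by
        rw [← h.column, ← h'.column, mul_assoc, mul_assoc, hc, sub_self]

/-- The index type of the components of a contractive Schur idempotent. -/
abbrev Component (D : StarSubalgebra ℂ (B H)) (Ψ : B H →L[ℂ] B H) : Type _ :=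
  {c : B H × B H // IsComponent D Ψ c.1 c.2}

/-- The left projection of a component. -/
def leftProj (c : Component D Ψ) : B H := c.1.1

/-- The right projection of a component. -/
def rightProj (c : Component D Ψ) : B H := c.1.2

theorem isComponent (c : Component D Ψ) : IsComponent D Ψ (leftProj c) (rightProj c) := c.2

theorem orthogonalProjections_leftProj (hD : IsMasa D) :
    OrthogonalProjections (leftProj : Component D Ψ → B H) where
  proj c := (isComponent c).left_proj
  mul_eq_zero c d hcd := by
    by_contra hne
    have hr := (isComponent c).right_eq (isComponent d) hD hne
    refine hcd (Subtype.ext (Prod.ext ((isComponent c).left_eq (isComponent d) hD ?_) hr))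
    rw [← hr, (isComponent c).right_proj.isIdempotentElem.eq]
    exact (isComponent c).right_ne

theorem orthogonalProjections_rightProj (hD : IsMasa D) :
    OrthogonalProjections (rightProj : Component D Ψ → B H) where
  proj c := (isComponent c).right_proj
  mul_eq_zero c d hcd := by
    by_contra hne
    have hl := (isComponent c).left_eq (isComponent d) hD hne
    refine hcd (Subtype.ext (Prod.ext hl ((isComponent c).right_eq (isComponent d) hD ?_)))
    rw [← hl, (isComponent c).left_proj.isIdempotentElem.eq]
    exact (isComponent c).left_ne

/-- The supremum of the left projections of the components. -/
def leftSupport (D : StarSubalgebra ℂ (B H)) (Ψ : B H →L[ℂ] B H) : B H :=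
  supportProj (leftProj : Component D Ψ → B H)

theorem leftSupport_mem (hD : IsMasa D) : leftSupport D Ψ ∈ D :=
  hD.supportProj_mem fun c => (isComponent c).left_mem

theorem IsContrIdem.leftSupport_mul (h : IsContrIdem D Ψ) (hD : IsMasa D) (T : B H) :
    leftSupport D Ψ * Ψ T = Ψ T := by
  by_contra hne
  obtain ⟨P, Q, hPQ, hP⟩ := h.exists_component hD
    (isStarProjection_supportProj (leftProj : Component D Ψ → B H)).one_sub
    (sub_mem (one_mem D) (leftSupport_mem hD))
    ⟨T, fun h0 => hne (by
      change (1 - leftSupport D Ψ) * Ψ T = 0 at h0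
      rw [sub_mul, one_mul, sub_eq_zero] at h0
      exact h0.symm)⟩
  apply hP
  rw [mul_sub, mul_one, sub_eq_zero]
  exact ((orthogonalProjections_leftProj hD).mul_supportProj ⟨(P, Q), hPQ⟩).symm

theorem IsContrIdem.comm {Ψ₁ Ψ₂ : B H →L[ℂ] B H} (h₁ : IsContrIdem D Ψ₁) (h₂ : IsContrIdem D Ψ₂)
    (hD : IsMasa D) (T : B H) : Ψ₁ (Ψ₂ T) = Ψ₂ (Ψ₁ T) := by
  have hd₁ := (orthogonalProjections_leftProj (Ψ := Ψ₁) hD)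
  have hd₂ := (orthogonalProjections_leftProj (Ψ := Ψ₂) hD)
  have hz : ∀ (c : Component D Ψ₁) (d : Component D Ψ₂),
      leftProj c * (leftProj d * (Ψ₁ (Ψ₂ T) - Ψ₂ (Ψ₁ T))) = 0 := by
    intro c d
    have hc := isComponent c
    have hd := isComponent d
    have hl := hD.1 _ hc.left_mem _ hd.left_mem
    rw [mul_sub, mul_sub, sub_eq_zero]
    calc leftProj c * (leftProj d * Ψ₁ (Ψ₂ T))
        = leftProj d * (leftProj c * Ψ₁ (Ψ₂ T)) := by rw [← mul_assoc, hl, mul_assoc]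
      _ = leftProj c * (leftProj d * Ψ₂ T) * rightProj c := by
          rw [hc.row, ← mul_assoc, ← mul_assoc, ← mul_assoc, hl]
      _ = leftProj c * (leftProj d * T * rightProj d) * rightProj c := by rw [hd.row]
      _ = leftProj d * (leftProj c * T * rightProj c) * rightProj d := by
          have hr := hD.1 _ hc.right_mem _ hd.right_mem
          simp only [mul_assoc]
          rw [← hr, ← mul_assoc, ← mul_assoc (leftProj d), hl]
      _ = leftProj d * (leftProj c * Ψ₁ T) * rightProj d := by rw [hc.row]
      _ = leftProj c * (leftProj d * Ψ₁ T * rightProj d) := by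
          simp only [← mul_assoc]
          rw [hl]
      _ = leftProj c * (leftProj d * Ψ₂ (Ψ₁ T)) := by rw [hd.row]
  have hz₁ : ∀ d : Component D Ψ₂, leftProj d * (Ψ₁ (Ψ₂ T) - Ψ₂ (Ψ₁ T)) = 0 := by
    intro d
    have := hd₁.supportProj_mul_eq_zero fun c => hz c d
    have hl := hD.1 _ (leftSupport_mem (Ψ := Ψ₁) hD) _ (isComponent d).left_mem
    change leftSupport D Ψ₁ * _ = 0 at this
    rw [← mul_assoc, hl, mul_assoc, mul_sub, h₁.leftSupport_mul hD,
      ← h₂.mul_left (leftSupport_mem hD), h₁.leftSupport_mul hD] at this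
    exact this
  have := hd₂.supportProj_mul_eq_zero hz₁
  change leftSupport D Ψ₂ * _ = 0 at this
  rw [mul_sub, ← h₁.mul_left (leftSupport_mem hD), h₂.leftSupport_mul hD, h₂.leftSupport_mul hD,
    sub_eq_zero] at this
  exact this

section Arveson

omit [CompleteSpace H] in
theorem arveson_nonneg (T : B H) (X : Set (B H)) : 0 ≤ arveson T X :=
  Real.iSup_nonneg fun _ => Real.iInf_nonneg fun _ => norm_nonneg _

omit [CompleteSpace H] in
theorem bddBelow_norm_sub (T : B H) (X : Set (B H)) (ξ : H) :
    BddBelow (Set.range fun S : X => ‖T ξ - S.1 ξ‖) :=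
  ⟨0, by rintro _ ⟨S, rfl⟩; exact norm_nonneg _⟩

omit [CompleteSpace H] in
theorem iInf_norm_sub_le_arveson (T : B H) {X : Set (B H)} (hX : X.Nonempty) {ξ : H}
    (hξ : ‖ξ‖ = 1) : ⨅ S : X, ‖T ξ - S.1 ξ‖ ≤ arveson T X := by
  obtain ⟨S₀, hS₀⟩ := hX
  refine le_ciSup (f := fun ξ : {ξ : H // ‖ξ‖ = 1} => ⨅ S : X, ‖T ξ.1 - S.1 ξ.1‖)
    ⟨‖T - S₀‖, ?_⟩ ⟨ξ, hξ⟩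
  rintro _ ⟨η, rfl⟩
  refine (ciInf_le (bddBelow_norm_sub T X η.1) ⟨S₀, hS₀⟩).trans ?_
  simpa [η.2] using (T - S₀).le_opNorm η.1

omit [CompleteSpace H] in
theorem iInf_norm_sub_le_arveson_mul_norm (T : B H) {X : Set (B H)} (hX : X.Nonempty) (ξ : H) :
    ⨅ S : X, ‖T ξ - S.1 ξ‖ ≤ arveson T X * ‖ξ‖ := by
  rcases eq_or_ne ξ 0 with rfl | h0
  · obtain ⟨S₀, hS₀⟩ := hX
    exact (ciInf_le (bddBelow_norm_sub T X 0) ⟨S₀, hS₀⟩).trans (by simp)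
  have hpos : 0 < ‖ξ‖ := norm_pos_iff.2 h0
  have h1 := iInf_norm_sub_le_arveson T hX (ξ := ((‖ξ‖⁻¹ : ℝ) : ℂ) • ξ) (by
    rw [norm_smul, Complex.norm_real, norm_inv, norm_norm, inv_mul_cancel₀ hpos.ne'])
  simp only [map_smul, ← smul_sub, norm_smul, Complex.norm_real, norm_inv, norm_norm] at h1
  rw [← Real.mul_iInf_of_nonneg (inv_nonneg.2 hpos.le), inv_mul_le_iff₀ hpos] at h1
  rwa [mul_comm]

omit [CompleteSpace H] in
theorem norm_mul_mul_le_arveson {T E F : B H} {X : Set (B H)} (hX : X.Nonempty) (hE : ‖E‖ ≤ 1)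
    (hF : ‖F‖ ≤ 1) (h : ∀ S ∈ X, E * S * F = 0) : ‖E * T * F‖ ≤ arveson T X := by
  have : Nonempty X := hX.to_subtype
  refine ContinuousLinearMap.opNorm_le_bound _ (arveson_nonneg T X) fun x => ?_
  calc ‖E (T (F x))‖ ≤ ⨅ S : X, ‖T (F x) - S.1 (F x)‖ := le_ciInf fun S => by
        have hS : E (S.1 (F x)) = 0 := congrArg (fun Z : B H => Z x) (h S.1 S.2)
        have := E.le_of_opNorm_le hE (T (F x) - S.1 (F x))
        rwa [map_sub, hS, sub_zero, one_mul] at this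
    _ ≤ arveson T X * ‖F x‖ := iInf_norm_sub_le_arveson_mul_norm T hX (F x)
    _ ≤ arveson T X * ‖x‖ := by
        refine mul_le_mul_of_nonneg_left ?_ (arveson_nonneg T X)
        simpa using F.le_of_opNorm_le hF x

omit [CompleteSpace H] in
theorem arveson_mul_mul_le {T E F : B H} {X Y : Set (B H)} (hX : X.Nonempty) (hE : ‖E‖ ≤ 1)
    (hF : ‖F‖ ≤ 1) (h : ∀ S ∈ X, E * S * F ∈ Y) : arveson (E * T * F) Y ≤ arveson T X := by
  have : Nonempty X := hX.to_subtype
  refine Real.iSup_le (fun ξ => ?_) (arveson_nonneg T X)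
  calc ⨅ S : Y, ‖(E * T * F) ξ.1 - S.1 ξ.1‖ ≤ ⨅ S : X, ‖T (F ξ.1) - S.1 (F ξ.1)‖ :=
        le_ciInf fun S => by
          refine (ciInf_le (bddBelow_norm_sub _ Y ξ.1) ⟨_, h S.1 S.2⟩).trans ?_
          change ‖E (T (F ξ.1)) - E (S.1 (F ξ.1))‖ ≤ _
          rw [← map_sub]
          exact (E.le_of_opNorm_le hE _).trans_eq (one_mul _)
    _ ≤ arveson T X * ‖F ξ.1‖ := iInf_norm_sub_le_arveson_mul_norm T hX _
    _ ≤ arveson T X := by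
        refine mul_le_of_le_one_right (arveson_nonneg T X) ?_
        simpa [ξ.2] using F.le_of_opNorm_le hF ξ.1

omit [CompleteSpace H] in
theorem arveson_anti (T : B H) {X Y : Set (B H)} (hX : X.Nonempty) (hXY : X ⊆ Y) :
    arveson T Y ≤ arveson T X := by
  simpa using arveson_mul_mul_le (T := T) (E := 1) (F := 1) hX ContinuousLinearMap.norm_id_le
    ContinuousLinearMap.norm_id_le fun S hS => by simpa using hXY hS

end Arveson

end SchurHyper

namespace SchurHyper

open Filter Topology InnerProductSpace

variable {H : Type*} [NormedAddCommGroup H] [InnerProductSpace ℂ H] [CompleteSpace H]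
variable {D : StarSubalgebra ℂ (B H)} {Φ Ψ : B H →L[ℂ] B H}

theorem sum_leftProj_mul (s : Finset (Component D Ψ)) (T : B H) :
    (∑ c ∈ s, leftProj c) * Ψ T = ∑ c ∈ s, leftProj c * T * rightProj c := by
  rw [Finset.sum_mul]
  exact Finset.sum_congr rfl fun c _ => (isComponent c).row T

/-- A contractive Schur idempotent is controlled by the Arveson distance to its kernel. -/
theorem IsContrIdem.norm_apply_le_arveson (h : IsContrIdem D Ψ) (hD : IsMasa D) (T : B H) :
    ‖Ψ T‖ ≤ arveson T (Set.range (ContinuousLinearMap.id ℂ (B H) - Ψ)) := by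
  set α := arveson T (Set.range (ContinuousLinearMap.id ℂ (B H) - Ψ)) with hα
  have hα0 : 0 ≤ α := arveson_nonneg _ _
  have hp := orthogonalProjections_leftProj (Ψ := Ψ) hD
  have hq := orthogonalProjections_rightProj (Ψ := Ψ) hD
  have hle : ∀ c : Component D Ψ, ‖leftProj c * T * rightProj c‖ ≤ α := fun c => by
    refine norm_mul_mul_le_arveson (Set.range_nonempty _) (hp.proj c).norm_le (hq.proj c).norm_le ?_
    rintro _ ⟨S, rfl⟩
    change leftProj c * (S - Ψ S) * rightProj c = 0
    rw [mul_sub, sub_mul, (isComponent c).row, mul_assoc _ (rightProj c),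
      (hq.proj c).isIdempotentElem.eq, sub_self]
  refine ContinuousLinearMap.opNorm_le_bound _ hα0 fun x => ?_
  have hR : supportProj (leftProj : Component D Ψ → B H) (Ψ T x) = Ψ T x :=
    congrArg (fun S : B H => S x) (h.leftSupport_mul hD T)
  rw [← hR]
  refine hp.norm_supportProj_apply_le fun s => ?_
  refine le_of_sq_le_sq ?_ (by positivity)
  calc ‖(∑ c ∈ s, leftProj c) (Ψ T x)‖ ^ 2 = ∑ c ∈ s, ‖leftProj c (Ψ T x)‖ ^ 2 :=
        hp.norm_sum_sq s _
    _ ≤ ∑ c ∈ s, α ^ 2 * ‖rightProj c x‖ ^ 2 := by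
        refine Finset.sum_le_sum fun c _ => ?_
        have : leftProj c (Ψ T x) = (leftProj c * T * rightProj c) (rightProj c x) := by
          have h1 : leftProj c * Ψ T = leftProj c * T * rightProj c * rightProj c := by
            rw [(isComponent c).row, mul_assoc _ (rightProj c), (hq.proj c).isIdempotentElem.eq]
          exact congrArg (fun S : B H => S x) h1
        rw [this, ← mul_pow]
        exact pow_le_pow_left₀ (norm_nonneg _) (ContinuousLinearMap.le_of_opNorm_le _ (hle c) _) 2
    _ = α ^ 2 * ‖(∑ c ∈ s, rightProj c) x‖ ^ 2 := by rw [← Finset.mul_sum, hq.norm_sum_sq]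
    _ ≤ (α * ‖x‖) ^ 2 := by
        rw [mul_pow]
        refine mul_le_mul_of_nonneg_left (pow_le_pow_left₀ (norm_nonneg _) ?_ 2) (sq_nonneg α)
        simpa using ContinuousLinearMap.le_of_opNorm_le _ (hq.isStarProjection_sum s).norm_le x

theorem norm_offDiagonal_le (hD : IsMasa D) (T : B H) (s : Finset (Component D Ψ)) :
    ‖(∑ c ∈ s, leftProj c) * T * (∑ c ∈ s, rightProj c) - ∑ c ∈ s, leftProj c * T * rightProj c‖
      ≤ 4 * arveson T (Set.range Ψ) := by
  classical
  have hp := orthogonalProjections_leftProj (Ψ := Ψ) hD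
  have hq := orthogonalProjections_rightProj (Ψ := Ψ) hD
  have hle : ∀ ε ∈ s.powerset, ‖(∑ c ∈ ε, leftProj c) * T *
      (∑ c ∈ s, rightProj c - ∑ c ∈ ε, rightProj c)‖ ≤ arveson T (Set.range Ψ) := by
    intro ε hε
    have hεs := Finset.mem_powerset.1 hε
    refine norm_mul_mul_le_arveson (Set.range_nonempty _) (hp.isStarProjection_sum ε).norm_le ?_ ?_
    · rw [← Finset.sum_sdiff_eq_sub hεs]
      exact (hq.isStarProjection_sum _).norm_le
    · rintro _ ⟨S, rfl⟩
      rw [sum_leftProj_mul, Finset.sum_mul]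
      refine Finset.sum_eq_zero fun c hc => ?_
      rw [mul_assoc, mul_sub, hq.mul_sum_of_mem (hεs hc), hq.mul_sum_of_mem hc, sub_self, mul_zero]
  have hnorm : ∀ (n : ℕ) (Y : B H), ‖(n : B H) * Y‖ = n * ‖Y‖ := fun n Y => by
    rw [← nsmul_eq_mul, ← Nat.cast_smul_eq_nsmul ℂ, norm_smul, Complex.norm_natCast]
  have key := congrArg norm (four_mul_sum_powerset (leftProj : Component D Ψ → B H) rightProj T s)
  have h4 : ∀ Y : B H, ‖4 * Y‖ = 4 * ‖Y‖ := fun Y => by exact_mod_cast hnorm 4 Y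
  have h2 : ∀ Y : B H, ‖2 ^ s.card * Y‖ = 2 ^ s.card * ‖Y‖ := fun Y => by
    simpa only [Nat.cast_pow, Nat.cast_ofNat] using hnorm (2 ^ s.card) Y
  rw [h4, h2] at key
  have hsum := norm_sum_le_of_le s.powerset hle
  rw [Finset.sum_const, Finset.card_powerset, nsmul_eq_mul] at hsum
  push_cast at hsum
  have hpos : (0 : ℝ) < 2 ^ s.card := by positivity
  refine le_of_mul_le_mul_left ?_ hpos
  rw [← key]
  linarith

/-- A contractive Schur idempotent belongs to `𝔉H`. -/
theorem IsContrIdem.norm_sub_apply_le_arveson (h : IsContrIdem D Ψ) (hD : IsMasa D) (T : B H) :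
    ‖T - Ψ T‖ ≤ 6 * arveson T (Set.range Ψ) := by
  set α := arveson T (Set.range Ψ) with hα
  have hα0 : 0 ≤ α := arveson_nonneg _ _
  have hp := orthogonalProjections_leftProj (Ψ := Ψ) hD
  have hq := orthogonalProjections_rightProj (Ψ := Ψ) hD
  have hR := isStarProjection_supportProj (leftProj : Component D Ψ → B H)
  have h1 : ‖(1 - leftSupport D Ψ) * T * 1‖ ≤ α := by
    refine norm_mul_mul_le_arveson (Set.range_nonempty _) hR.one_sub.norm_le
      ContinuousLinearMap.norm_id_le ?_
    rintro _ ⟨S, rfl⟩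
    rw [sub_mul, h.leftSupport_mul hD, one_mul, sub_self, zero_mul]
  have h2 : ∀ s : Finset (Component D Ψ), ‖(∑ c ∈ s, leftProj c) * (T - Ψ T)‖ ≤ 5 * α := by
    intro s
    have h3 : ‖(∑ c ∈ s, leftProj c) * T * (1 - ∑ c ∈ s, rightProj c)‖ ≤ α := by
      refine norm_mul_mul_le_arveson (Set.range_nonempty _) (hp.isStarProjection_sum s).norm_le
        (hq.isStarProjection_sum s).one_sub.norm_le ?_
      rintro _ ⟨S, rfl⟩
      rw [sum_leftProj_mul, Finset.sum_mul]
      refine Finset.sum_eq_zero fun c hc => ?_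
      rw [mul_assoc, mul_sub, hq.mul_sum_of_mem hc, mul_one, sub_self, mul_zero]
    have h4 := norm_offDiagonal_le hD T s
    have : (∑ c ∈ s, leftProj c) * (T - Ψ T)
        = (∑ c ∈ s, leftProj c) * T * (1 - ∑ c ∈ s, rightProj c)
          + ((∑ c ∈ s, leftProj c) * T * (∑ c ∈ s, rightProj c)
            - ∑ c ∈ s, leftProj c * T * rightProj c) := by
      rw [mul_sub, sum_leftProj_mul]
      noncomm_ring
    rw [this]
    refine (norm_add_le _ _).trans ?_
    linarith
  have h5 : ‖leftSupport D Ψ * (T - Ψ T)‖ ≤ 5 * α := by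
    refine ContinuousLinearMap.opNorm_le_bound _ (by positivity) fun x => ?_
    exact hp.norm_supportProj_apply_le fun s => ContinuousLinearMap.le_of_opNorm_le _ (h2 s) x
  have : T - Ψ T = (1 - leftSupport D Ψ) * T * 1 + leftSupport D Ψ * (T - Ψ T) := by
    rw [mul_sub, h.leftSupport_mul hD]
    noncomm_ring
  rw [this]
  refine (norm_add_le _ _).trans ?_
  linarith

theorem IsSchurIdempotent.compl (h : IsSchurIdempotent D Φ) :
    IsSchurIdempotent D (ContinuousLinearMap.id ℂ (B H) - Φ) := by
  refine ⟨⟨wStarContinuous_id.sub h.1.1, fun A hA C hC T => ?_⟩, ?_⟩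
  · change A * T * C - Φ (A * T * C) = A * (T - Φ T) * C
    rw [h.1.2 A hA C hC, mul_sub, sub_mul]
  · have : IsIdempotentElem Φ := h.2
    exact this.one_sub

theorem IsSchurIdempotent.comp (hΦ : IsSchurIdempotent D Φ) (hΨ : IsSchurIdempotent D Ψ)
    (hc : Commute Φ Ψ) : IsSchurIdempotent D (Φ.comp Ψ) := by
  refine ⟨⟨hΦ.1.1.comp hΨ.1.1, fun A hA C hC T => ?_⟩, ?_⟩
  · change Φ (Ψ (A * T * C)) = A * Φ (Ψ T) * C
    rw [hΨ.1.2 A hA C hC, hΦ.1.2 A hA C hC]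
  · exact IsIdempotentElem.mul_of_commute hc (show IsIdempotentElem Φ from hΦ.2)
      (show IsIdempotentElem Ψ from hΨ.2)

theorem add_mul_mem_lamSet_comp (hc : Commute Φ Ψ) {k l : ℝ} (hk : k ∈ lamSet Φ)
    (hl : l ∈ lamSet Ψ) : k + ‖Φ‖ * l ∈ lamSet (Φ.comp Ψ) := by
  refine ⟨add_pos_of_pos_of_nonneg hk.1 (mul_nonneg (norm_nonneg _) hl.1.le), fun T => ?_⟩
  have hΦ : arveson T (Set.range Φ) ≤ arveson T (Set.range (Φ.comp Ψ)) :=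
    arveson_anti T (Set.range_nonempty _) (Set.range_comp_subset_range Ψ Φ)
  have hΨ : arveson T (Set.range Ψ) ≤ arveson T (Set.range (Φ.comp Ψ)) := by
    refine arveson_anti T (Set.range_nonempty _) ?_
    have : Φ.comp Ψ = Ψ.comp Φ := hc
    rw [this]
    exact Set.range_comp_subset_range Φ Ψ
  calc ‖T - Φ (Ψ T)‖ = ‖(T - Φ T) + Φ (T - Ψ T)‖ := by rw [map_sub]; abel_nf
    _ ≤ ‖T - Φ T‖ + ‖Φ‖ * ‖T - Ψ T‖ := (norm_add_le _ _).trans (by gcongr; exact Φ.le_opNorm _)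
    _ ≤ k * arveson T (Set.range (Φ.comp Ψ))
        + ‖Φ‖ * (l * arveson T (Set.range (Φ.comp Ψ))) := by
        refine add_le_add ((hk.2 T).trans ?_) ?_
        · exact mul_le_mul_of_nonneg_left hΦ hk.1.le
        · refine mul_le_mul_of_nonneg_left ((hl.2 T).trans ?_) (norm_nonneg _)
          exact mul_le_mul_of_nonneg_left hΨ hl.1.le
    _ = _ := by ring

/-- Projections `E`, `F` of the masa, with `F` fixing `ξ`, such that `E` annihilates `ran Φ` on the
range of `F` and computes the distance to the orbit of `ξ` under `ran Φ`. -/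
theorem IsSchurMultiplier.exists_annihilator (h : IsSchurMultiplier D Φ) (hD : IsMasa D) (ξ : H) :
    ∃ E F : B H, E ∈ D ∧ F ∈ D ∧ ‖E‖ ≤ 1 ∧ ‖F‖ ≤ 1 ∧ F ξ = ξ ∧ (∀ A, E * Φ A * F = 0) ∧
      ∀ y : H, ⨅ S : Set.range Φ, ‖y - S.1 ξ‖ ≤ ‖E y‖ := by
  set K : Submodule ℂ H :=
    (LinearMap.range ((ContinuousLinearMap.apply ℂ H ξ).comp Φ).toLinearMap).topologicalClosure
    with hK
  have hKc : IsClosed (K : Set H) := Submodule.isClosed_topologicalClosure _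
  have hmem : ∀ A, Φ A ξ ∈ K := fun A => Submodule.le_topologicalClosure _ ⟨A, rfl⟩
  have : CompleteSpace K := hKc.completeSpace_coe
  have hinv : ∀ A ∈ D, ∀ x ∈ K, A x ∈ K := by
    intro A hA x hx
    have hle : K ≤ K.comap A.toLinearMap := by
      refine Submodule.topologicalClosure_minimal _ ?_ (hKc.preimage A.continuous)
      rintro _ ⟨T, rfl⟩
      change A (Φ T ξ) ∈ K
      have := h.2 A hA 1 (one_mem D) T
      rw [mul_one, mul_one] at this
      rw [← show Φ (A * T) ξ = A (Φ T ξ) from congrArg (fun S : B H => S ξ) this]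
      exact hmem _
    exact hle hx
  have hE0 : ∀ x ∈ K, (1 - K.starProjection) x = 0 := fun x hx => by
    change x - K.starProjection x = 0
    rw [Submodule.starProjection_eq_self_iff.2 hx, sub_self]
  refine ⟨1 - K.starProjection, (cyclicSubspace D ξ).starProjection,
    sub_mem (one_mem D) (hD.starProjection_mem K hinv), hD.cyclic_mem ξ,
    isStarProjection_starProjection.one_sub.norm_le, isStarProjection_starProjection.norm_le,
    starProjection_cyclic_self ξ, fun A => ?_, fun y => ?_⟩
  · rw [mul_starProjection_cyclic_eq (W := 0) fun C hC => ?_, zero_mul]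
    change (1 - K.starProjection) (Φ A (C ξ)) = 0
    have := h.2 1 (one_mem D) C hC A
    rw [one_mul, one_mul] at this
    rw [← show Φ (A * C) ξ = Φ A (C ξ) from congrArg (fun S : B H => S ξ) this]
    exact hE0 _ (hmem _)
  · refine le_of_forall_pos_le_add fun ε hε => ?_
    obtain ⟨_, ⟨A, rfl⟩, hA⟩ := Metric.mem_closure_iff.1
      (show K.starProjection y ∈ closure _ from K.starProjection_apply_mem y) ε hε
    change dist (K.starProjection y) (Φ A ξ) < ε at hA
    rw [dist_eq_norm] at hA
    refine (ciInf_le ⟨0, by rintro _ ⟨S, rfl⟩; exact norm_nonneg _⟩ ⟨Φ A, A, rfl⟩).trans ?_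
    calc ‖y - Φ A ξ‖ = ‖(y - K.starProjection y) + (K.starProjection y - Φ A ξ)‖ := by
          rw [sub_add_sub_cancel]
      _ ≤ ‖y - K.starProjection y‖ + ε := (norm_add_le _ _).trans (by gcongr)

theorem mul_mem_lamSet_join (hD : IsMasa D) (hΦ : IsSchurIdempotent D Φ)
    (hΨ : IsSchurIdempotent D Ψ) {k l : ℝ} (hk : k ∈ lamSet Φ) (hl : l ∈ lamSet Ψ) :
    k * l ∈ lamSet (Φ + Ψ - Φ.comp Ψ) := by
  refine ⟨mul_pos hk.1 hl.1, fun T => ?_⟩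
  set α := arveson T (Set.range (Φ + Ψ - Φ.comp Ψ)) with hα
  have hle : arveson (T - Ψ T) (Set.range Φ) ≤ l * α := by
    refine Real.iSup_le (fun ξ => ?_) (mul_nonneg hl.1.le (arveson_nonneg _ _))
    obtain ⟨E, F, hED, hFD, hE, hF, hFξ, hEF, hinf⟩ := hΦ.1.exists_annihilator hD ξ.1
    have h1 : E ((T - Ψ T) ξ.1) = (E * T * F - Ψ (E * T * F)) ξ.1 := by
      rw [hΨ.1.2 E hED F hFD, ← sub_mul, ← mul_sub]
      change _ = E ((T - Ψ T) (F ξ.1))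
      rw [hFξ]
    have h2 : arveson (E * T * F) (Set.range Ψ) ≤ α := by
      refine arveson_mul_mul_le (Set.range_nonempty _) hE hF ?_
      rintro _ ⟨A, rfl⟩
      refine ⟨E * A * F, ?_⟩
      change _ = E * (Φ A + Ψ A - Φ (Ψ A)) * F
      rw [hΨ.1.2 E hED F hFD, mul_sub, mul_add, sub_mul, add_mul, hEF, hEF, zero_add, sub_zero]
    calc ⨅ S : Set.range Φ, ‖(T - Ψ T) ξ.1 - S.1 ξ.1‖ ≤ ‖E ((T - Ψ T) ξ.1)‖ := hinf _
      _ ≤ ‖E * T * F - Ψ (E * T * F)‖ := by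
          rw [h1]
          simpa [ξ.2] using (E * T * F - Ψ (E * T * F)).le_opNorm ξ.1
      _ ≤ l * arveson (E * T * F) (Set.range Ψ) := hl.2 _
      _ ≤ l * α := mul_le_mul_of_nonneg_left h2 hl.1.le
  calc ‖T - (Φ T + Ψ T - Φ (Ψ T))‖ = ‖(T - Ψ T) - Φ (T - Ψ T)‖ := by rw [map_sub]; abel_nf
    _ ≤ k * arveson (T - Ψ T) (Set.range Φ) := hk.2 _
    _ ≤ k * (l * α) := mul_le_mul_of_nonneg_left hle hk.1.le
    _ = k * l * α := by ring

theorem InC.commute (hD : IsMasa D) (hΦ : InC D Φ) (hΨ : InC D Ψ) : Commute Φ Ψ := by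
  have hone : ∀ Θ : B H →L[ℂ] B H, Commute (ContinuousLinearMap.id ℂ (B H)) Θ := Commute.one_left
  induction hΦ with
  | compl Φ _ ih => exact (hone Ψ).sub_left ih
  | meet Φ₁ Φ₂ _ _ ih₁ ih₂ => exact Commute.mul_left ih₁ ih₂
  | join Φ₁ Φ₂ _ _ ih₁ ih₂ => exact (ih₁.add_left ih₂).sub_left (Commute.mul_left ih₁ ih₂)
  | base Φ h hc =>
    induction hΨ with
    | compl Ψ _ ih => exact (hone Φ).symm.sub_right ih
    | meet Ψ₁ Ψ₂ _ _ ih₁ ih₂ => exact Commute.mul_right ih₁ ih₂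
    | join Ψ₁ Ψ₂ _ _ ih₁ ih₂ => exact (ih₁.add_right ih₂).sub_right (Commute.mul_right ih₁ ih₂)
    | base Ψ h' hc' =>
      exact ContinuousLinearMap.ext ((h.isContrIdem hc).comm (h'.isContrIdem hc') hD)

theorem InC.memFH_and_memFH_compl (hD : IsMasa D) (h : InC D Φ) :
    MemFH D Φ ∧ MemFH D (ContinuousLinearMap.id ℂ (B H) - Φ) := by
  have hmeet : ∀ {Φ Ψ : B H →L[ℂ] B H}, Commute Φ Ψ → MemFH D Φ → MemFH D Ψ →
      MemFH D (Φ.comp Ψ) := by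
    rintro Φ Ψ hc ⟨h₁, _, hk⟩ ⟨h₂, _, hl⟩
    exact ⟨h₁.comp h₂ hc, _, add_mul_mem_lamSet_comp hc hk hl⟩
  have hcompl : ∀ Φ : B H →L[ℂ] B H,
      ContinuousLinearMap.id ℂ (B H) - (ContinuousLinearMap.id ℂ (B H) - Φ) = Φ :=
    fun Φ => sub_sub_cancel _ Φ
  have hdm : ∀ Φ Ψ : B H →L[ℂ] B H,
      (ContinuousLinearMap.id ℂ (B H) - Φ).comp (ContinuousLinearMap.id ℂ (B H) - Ψ)
        = ContinuousLinearMap.id ℂ (B H) - (Φ + Ψ - Φ.comp Ψ) := fun Φ Ψ =>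
    show (1 - Φ) * (1 - Ψ) = 1 - (Φ + Ψ - Φ * Ψ) by
      rw [mul_sub, mul_one, sub_mul, one_mul]
      abel
  have hone : ∀ Θ : B H →L[ℂ] B H, Commute (ContinuousLinearMap.id ℂ (B H)) Θ := Commute.one_left
  have hcc : ∀ {Φ Ψ : B H →L[ℂ] B H}, Commute Φ Ψ →
      Commute (ContinuousLinearMap.id ℂ (B H) - Φ) (ContinuousLinearMap.id ℂ (B H) - Ψ) :=
    fun hc => (hone _).sub_left ((hone _).symm.sub_right hc)
  have hjoin : ∀ {Φ Ψ : B H →L[ℂ] B H}, Commute Φ Ψ → MemFH D Φ → MemFH D Ψ →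
      MemFH D (Φ + Ψ - Φ.comp Ψ) := by
    rintro Φ Ψ hc ⟨h₁, _, hk⟩ ⟨h₂, _, hl⟩
    refine ⟨?_, _, mul_mem_lamSet_join hD h₁ h₂ hk hl⟩
    have := (h₁.compl.comp h₂.compl (hcc hc)).compl
    rwa [hdm, hcompl] at this
  induction h with
  | base Φ h hc =>
    refine ⟨⟨h, 6, by norm_num, (h.isContrIdem hc).norm_sub_apply_le_arveson hD⟩, h.compl, 1,
      one_pos, fun T => ?_⟩
    rw [one_mul, show T - (ContinuousLinearMap.id ℂ (B H) - Φ) T = Φ T from sub_sub_cancel T _]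
    exact (h.isContrIdem hc).norm_apply_le_arveson hD T
  | compl Φ _ ih => exact ⟨ih.2, by rw [hcompl]; exact ih.1⟩
  | meet Φ Ψ h₁ h₂ ih₁ ih₂ =>
    have hc := h₁.commute hD h₂
    refine ⟨hmeet hc ih₁.1 ih₂.1, ?_⟩
    have := hjoin (hcc hc) ih₁.2 ih₂.2
    rw [hdm] at this
    convert this using 1
    abel
  | join Φ Ψ h₁ h₂ ih₁ ih₂ =>
    have hc := h₁.commute hD h₂
    refine ⟨hjoin hc ih₁.1 ih₂.1, ?_⟩
    rw [← hdm]
    exact hmeet (hcc hc) ih₁.2 ih₂.2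

theorem hyperreflexive_range_of_memFH (h : MemFH D Φ) : Hyperreflexive (Set.range Φ) := by
  obtain ⟨-, k, hk, hle⟩ := h
  refine ⟨k, hk, fun T => (Metric.infDist_le_dist_of_mem (Set.mem_range_self T)).trans ?_⟩
  rw [dist_eq_norm]
  exact hle T

end SchurHyper

/-- every Schur idempotent in the Boolean lattice `𝔠(H)` generated
by the contractive Schur idempotents belongs to `𝔉H`; in particular its range
is hyperreflexive. -/
theorem stmt7 {H : Type*} [NormedAddCommGroup H] [InnerProductSpace ℂ H] [CompleteSpace H]
    [TopologicalSpace.SeparableSpace H]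
    (D : StarSubalgebra ℂ (B H)) (hD : IsMasa D)
    (Φ : B H →L[ℂ] B H) (h : InC D Φ) :
    MemFH D Φ ∧ Hyperreflexive (Set.range ⇑Φ) := by
  have hΦ := (h.memFH_and_memFH_compl hD).1
  exact ⟨hΦ, hyperreflexive_range_of_memFH hΦ⟩
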